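/- For every integer ℓ ≥ 95 there exists a simple graph G admitting a straight-line RAC drawing, with exactly n = 45ℓ + 16 vertices, such that cr_{RAC}(G) ≥ ℓ² and cr(G) ≤ 2; moreover the straight-line RAC crossing ratio is Θ(n²). -/

import Mathlib

open Set

noncomputable section

/-- A drawing of a simple graph in the plane: vertices are mapped to distinct
points, each edge `uv` is drawn as a simple arc joining the images of `u` and
`v` and avoiding the images of the other vertices, any two arcs meet in
finitely many points, and no three arcs pass through a common non-vertex
point. -/
structure Drawing {V : Type} (G : SimpleGraph V) where
  vpos : V → ℝ × ℝ
  vpos_inj : Function.Injective vpos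
  arc : V → V → ℝ → ℝ × ℝ
  arc_symm : ∀ u v t, arc u v t = arc v u (1 - t)
  arc_cont : ∀ u v, G.Adj u v → ContinuousOn (arc u v) (Set.Icc 0 1)
  arc_injOn : ∀ u v, G.Adj u v → Set.InjOn (arc u v) (Set.Icc 0 1)
  arc_start : ∀ u v, G.Adj u v → arc u v 0 = vpos u
  arc_end : ∀ u v, G.Adj u v → arc u v 1 = vpos v
  arc_avoids : ∀ u v, G.Adj u v → ∀ t ∈ Set.Ioo (0:ℝ) 1, arc u v t ∉ Set.range vpos
  inter_finite : ∀ u v w z, G.Adj u v → G.Adj w z → s(u, v) ≠ s(w, z) →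
    ((arc u v '' Set.Icc 0 1) ∩ (arc w z '' Set.Icc 0 1)).Finite
  no_triple_point : ∀ p : ℝ × ℝ, p ∉ Set.range vpos →
    ∀ u₁ v₁ u₂ v₂ u₃ v₃, G.Adj u₁ v₁ → G.Adj u₂ v₂ → G.Adj u₃ v₃ →
      s(u₁, v₁) ≠ s(u₂, v₂) → s(u₁, v₁) ≠ s(u₃, v₃) → s(u₂, v₂) ≠ s(u₃, v₃) →
      ¬ (p ∈ arc u₁ v₁ '' Set.Icc 0 1 ∧ p ∈ arc u₂ v₂ '' Set.Icc 0 1 ∧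
          p ∈ arc u₃ v₃ '' Set.Icc 0 1)

namespace Drawing

variable {V : Type} {G : SimpleGraph V}

lemma img_symm_aux (Γ : Drawing G) (u v : V) :
    Γ.arc u v '' Set.Icc 0 1 = Γ.arc v u '' Set.Icc 0 1 := by
  have key : ∀ a b : V, Γ.arc a b '' Set.Icc 0 1 ⊆ Γ.arc b a '' Set.Icc 0 1 := by
    rintro a b p ⟨t, ht, rfl⟩
    refine ⟨1 - t, ⟨by linarith [ht.2], by linarith [ht.1]⟩, ?_⟩
    rw [Γ.arc_symm b a (1 - t)]
    congr 1
    ring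
  exact Set.Subset.antisymm (key u v) (key v u)

/-- The image (trace) of an edge in the drawing. -/
def img (Γ : Drawing G) (e : Sym2 V) : Set (ℝ × ℝ) :=
  Sym2.lift ⟨fun u v => Γ.arc u v '' Set.Icc 0 1, fun u v => Γ.img_symm_aux u v⟩ e

/-- `p` is a crossing point of the two distinct edges `e` and `f` : it lies on
both arcs and is not the image of a vertex (so it is not a shared endpoint). -/
def Crossing (Γ : Drawing G) (e f : Sym2 V) (p : ℝ × ℝ) : Prop :=
  e ∈ G.edgeSet ∧ f ∈ G.edgeSet ∧ e ≠ f ∧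
    p ∈ Γ.img e ∧ p ∈ Γ.img f ∧ p ∉ Set.range Γ.vpos

/-- The edges `e` and `f` cross in the drawing. -/
def Crosses (Γ : Drawing G) (e f : Sym2 V) : Prop := ∃ p, Γ.Crossing e f p

/-- The set of crossing points of a drawing. -/
def crossingSet (Γ : Drawing G) : Set (ℝ × ℝ) := {p | ∃ e f, Γ.Crossing e f p}

/-- The number of crossings of a drawing. -/
def crossings (Γ : Drawing G) : ℕ := Γ.crossingSet.ncard

/-- The set of crossing points lying on a given edge. -/
def edgeCrossings (Γ : Drawing G) (e : Sym2 V) : Set (ℝ × ℝ) :=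
  {p | ∃ f, Γ.Crossing e f p}

/-- A drawing is `k`-planar if every edge is involved in at most `k` crossings. -/
def IsKPlanar (Γ : Drawing G) (k : ℕ) : Prop :=
  ∀ e ∈ G.edgeSet, (Γ.edgeCrossings e).ncard ≤ k

/-- A drawing is `k`-gap-planar if each crossing can be assigned to one of its
two involved edges such that every edge is assigned at most `k` crossings. -/
def IsKGapPlanar (Γ : Drawing G) (k : ℕ) : Prop :=
  ∃ assign : ℝ × ℝ → Sym2 V,
    (∀ p ∈ Γ.crossingSet, ∃ f, Γ.Crossing (assign p) f p) ∧
    ∀ e : Sym2 V, {p | p ∈ Γ.crossingSet ∧ assign p = e}.ncard ≤ k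

/-- A drawing is skewness-`k` if there is a set of at most `k` edges such that
every crossing involves an edge from the set. -/
def IsSkewness (Γ : Drawing G) (k : ℕ) : Prop :=
  ∃ S : Finset (Sym2 V), S.card ≤ k ∧
    ∀ p ∈ Γ.crossingSet, ∃ e ∈ S, ∃ f, Γ.Crossing e f p

/-- A drawing is `k`-apex if there is a set of at most `k` vertices such that
every crossing involves an edge incident to one of these vertices. -/
def IsKApex (Γ : Drawing G) (k : ℕ) : Prop :=
  ∃ S : Finset V, S.card ≤ k ∧
    ∀ p ∈ Γ.crossingSet, ∃ e f, Γ.Crossing e f p ∧ ∃ a ∈ S, a ∈ e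

/-- A drawing is `(k,l)`-grid-free if there is no set of `k` edges each of
which crosses each edge of some set of `l` edges. -/
def IsGridFree (Γ : Drawing G) (k l : ℕ) : Prop :=
  ¬ ∃ A B : Finset (Sym2 V), A.card = k ∧ B.card = l ∧
      ∀ e ∈ A, ∀ f ∈ B, Γ.Crosses e f

/-- A drawing is `k`-fan-crossing-free if no edge crosses `k` edges that all
share a common endpoint. -/
def IsKFanCrossingFree (Γ : Drawing G) (k : ℕ) : Prop :=
  ¬ ∃ (e : Sym2 V) (a : V) (F : Finset (Sym2 V)), F.card = k ∧
      ∀ f ∈ F, a ∈ f ∧ Γ.Crosses e f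

/-- A drawing is planarly connected if for any two crossing edges, two of
their endpoints are joined by a crossing-free edge. -/
def IsPlanarlyConnected (Γ : Drawing G) : Prop :=
  ∀ e f : Sym2 V, Γ.Crosses e f →
    ∃ a b : V, a ∈ e ∧ b ∈ f ∧ G.Adj a b ∧ Γ.edgeCrossings s(a, b) = ∅

/-- A drawing is straight-line if every edge is drawn as the line segment
between the images of its endpoints. -/
def IsStraight (Γ : Drawing G) : Prop :=
  ∀ u v : V, G.Adj u v → ∀ t ∈ Set.Icc (0:ℝ) 1,
    Γ.arc u v t = (1 - t) • Γ.vpos u + t • Γ.vpos v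

/-- A straight-line RAC drawing: straight-line and any two crossing edges are
perpendicular. -/
def IsRAC (Γ : Drawing G) : Prop :=
  Γ.IsStraight ∧
    ∀ u v w z : V, G.Adj u v → G.Adj w z → Γ.Crosses s(u, v) s(w, z) →
      (Γ.vpos v - Γ.vpos u).1 * (Γ.vpos z - Γ.vpos w).1 +
        (Γ.vpos v - Γ.vpos u).2 * (Γ.vpos z - Γ.vpos w).2 = 0

end Drawing

/-- The crossing number of `G`: the minimum number of crossings over all
drawings of `G`. -/
def crNum {V : Type} (G : SimpleGraph V) : ℕ :=
  sInf {n | ∃ Γ : Drawing G, Γ.crossings = n}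

/-- The crossing number of `G` restricted to drawings satisfying `P`. -/
def crNumRestricted {V : Type} (G : SimpleGraph V) (P : Drawing G → Prop) : ℕ :=
  sInf {n | ∃ Γ : Drawing G, P Γ ∧ Γ.crossings = n}

/-- The rectilinear crossing number of `G`. -/
def rectCrNum {V : Type} (G : SimpleGraph V) : ℕ :=
  crNumRestricted G (fun Γ => Γ.IsStraight)

/-- An ℓ₂-bundle between `x` and `y`: `P` is the set of the internal vertices
of ℓ internally disjoint paths of length two from `x` to `y`, all of whose
internal vertices have degree exactly two in `G` (here ℓ = `P.card`). -/
def IsL2Bundle {V : Type} (G : SimpleGraph V) (x y : V) (P : Finset V) : Prop :=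
  x ≠ y ∧ x ∉ P ∧ y ∉ P ∧
    ∀ p ∈ P, G.Adj x p ∧ G.Adj p y ∧ (G.neighborSet p).ncard = 2

/-- Two drawings of `G` are weakly isomorphic: there is an incidence-preserving
one-to-one correspondence of vertices and edges that preserves crossings. -/
def WeaklyIso {V : Type} {G : SimpleGraph V} (Γ Γ' : Drawing G) : Prop :=
  ∃ φ : G ≃g G, ∀ e f : Sym2 V,
    Γ.Crosses e f ↔ Γ'.Crosses (Sym2.map (fun a => φ a) e) (Sym2.map (fun a => φ a) f)

/-- The total change of a continuous logarithm of `f` between the times `0` and `1`. -/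
def logChange (f : ℝ → ℂ) : ℂ :=
  open Classical in
  if h : ∃ L : ℝ → ℂ, Continuous L ∧ ∀ t, Complex.exp (L t) = f t then
    h.choose 1 - h.choose 0 else 0

lemma logChange_eq {f L : ℝ → ℂ} (hL : Continuous L) (hf : ∀ t, Complex.exp (L t) = f t) :
    logChange f = L 1 - L 0 := by
  have h : ∃ L : ℝ → ℂ, Continuous L ∧ ∀ t, Complex.exp (L t) = f t := ⟨L, hL, hf⟩
  rw [logChange, dif_pos h]
  obtain ⟨hK, hKf⟩ := h.choose_spec
  set K := h.choose
  have hint : ∀ t, ∃ n : ℤ, K t = L t + n * (2 * Real.pi * Complex.I) := fun t =>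
    Complex.exp_eq_exp_iff_exists_int.1 ((hKf t).trans (hf t).symm)
  choose n hn using hint
  have hc : Continuous fun t => (n t : ℝ) := by
    have : (fun t => (n t : ℝ)) = fun t => (K t - L t).im / (2 * Real.pi) := by
      funext t
      rw [hn t]
      simp [Real.pi_ne_zero]
    rw [this]
    fun_prop
  have hc' : Continuous n := Int.isClosedEmbedding_coe_real.isEmbedding.continuous_iff.2 hc
  have hn' : n 0 = n 1 := PreconnectedSpace.constant inferInstance hc'
  rw [hn 1, hn 0, hn']
  ring

lemma exists_continuous_log {X : Type*} [TopologicalSpace X] [SimplyConnectedSpace X]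
    [LocallyPathConnectedSpace X] {g : X → ℂ} (hg : Continuous g) (h0 : ∀ x, g x ≠ 0) :
    ∃ L : X → ℂ, Continuous L ∧ ∀ x, Complex.exp (L x) = g x := by
  obtain ⟨x₀⟩ : Nonempty X := inferInstance
  obtain ⟨L, ⟨-, h⟩, -⟩ := Complex.isCoveringMapOn_exp.existsUnique_continuousMap_lifts
    ⟨g, hg⟩ (Complex.exp_log (h0 x₀)) h0
  exact ⟨L, L.continuous, congr_fun h⟩

lemma logChange_neg {f : ℝ → ℂ} (hf : Continuous f) (h0 : ∀ t, f t ≠ 0) :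
    logChange (fun t => -f t) = logChange f := by
  obtain ⟨L, hL, h⟩ := exists_continuous_log hf h0
  rw [logChange_eq hL h, logChange_eq (L := fun t => L t + Real.pi * Complex.I) (by fun_prop)
    (fun t => by rw [Complex.exp_add, h, Complex.exp_pi_mul_I, mul_neg_one])]
  ring

lemma exists_int_logChange {f : ℝ → ℂ} (hf : Continuous f) (h0 : ∀ t, f t ≠ 0) {x y : ℂ}
    (hx : Complex.exp x = f 0) (hy : Complex.exp y = f 1) :
    ∃ n : ℤ, logChange f = y - x + n * (2 * Real.pi * Complex.I) := by
  obtain ⟨L, hL, h⟩ := exists_continuous_log hf h0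
  obtain ⟨k, hk⟩ := Complex.exp_eq_exp_iff_exists_int.1 ((h 0).trans hx.symm)
  obtain ⟨m, hm⟩ := Complex.exp_eq_exp_iff_exists_int.1 ((h 1).trans hy.symm)
  refine ⟨m - k, ?_⟩
  rw [logChange_eq hL h, hk, hm]
  push_cast
  ring

/-- The angle swept out by the path `f` as seen from the point `v`, as a complex logarithm. -/
def swept (v : ℂ) {c d : ℂ} (f : Path c d) : ℂ := logChange fun t => f.extend t - v

lemma Path.extend_sub_ne_zero {v c d : ℂ} {f : Path c d} (hv : v ∉ range f) (t : ℝ) :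
    f.extend t - v ≠ 0 := by
  rw [sub_ne_zero]
  rintro rfl
  exact hv (f.extend_range ▸ mem_range_self t)

lemma swept_square {a b c d : ℂ} (e : Path a b) (f : Path c d)
    (hef : Disjoint (range e) (range f)) :
    swept a f + swept d e = swept c e + swept b f := by
  have hne : ∀ x : ℝ × ℝ, e.extend x.1 - f.extend x.2 ≠ 0 := fun x h => by
    refine Set.disjoint_left.1 hef (e.extend_range ▸ mem_range_self x.1) ?_
    rw [sub_eq_zero.1 h]
    exact f.extend_range ▸ mem_range_self x.2
  have hec := e.continuous_extend
  have hfc := f.continuous_extend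
  obtain ⟨L, hL, h⟩ := exists_continuous_log (X := ℝ × ℝ)
    (g := fun x => e.extend x.1 - f.extend x.2) (by fun_prop) hne
  have h1 : swept d e = L (1, 1) - L (0, 1) :=
    logChange_eq (L := fun t => L (t, 1)) (by fun_prop) (fun t => by simp [h])
  have h2 : swept c e = L (1, 0) - L (0, 0) :=
    logChange_eq (L := fun t => L (t, 0)) (by fun_prop) (fun t => by simp [h])
  have h3 : swept a f = L (0, 1) - L (0, 0) := by
    rw [swept, ← logChange_neg (by fun_prop)
      (Path.extend_sub_ne_zero fun ha => Set.disjoint_left.1 hef ⟨0, e.source⟩ ha)]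
    exact logChange_eq (L := fun t => L (0, t)) (by fun_prop) (fun t => by simp [h])
  have h4 : swept b f = L (1, 1) - L (1, 0) := by
    rw [swept, ← logChange_neg (by fun_prop)
      (Path.extend_sub_ne_zero fun ha => Set.disjoint_left.1 hef ⟨1, e.target⟩ ha)]
    exact logChange_eq (L := fun t => L (1, t)) (by fun_prop) (fun t => by simp [h])
  rw [h1, h2, h3, h4]
  ring

lemma exists_int_swept {v c d : ℂ} (f : Path c d) (hv : v ∉ range f) {x y : ℂ}
    (hx : Complex.exp x = c - v) (hy : Complex.exp y = d - v) :
    ∃ n : ℤ, swept v f = y - x + n * (2 * Real.pi * Complex.I) :=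
  exists_int_logChange (by have := f.continuous_extend; fun_prop) (Path.extend_sub_ne_zero hv)
    (by simpa using hx) (by simpa using hy)

/-- Logarithms of the differences of distinct complex numbers, with a prescribed sign rule. -/
lemma exists_log_sub {p : Fin 3 → ℂ} (hp : Function.Injective p) :
    ∃ l : Fin 3 → Fin 3 → ℂ, (∀ i j, i ≠ j → Complex.exp (l i j) = p j - p i) ∧
      ∀ i j, i < j → l j i = l i j + Real.pi * Complex.I := by
  refine ⟨fun i j => if i < j then Complex.log (p j - p i) else
    Complex.log (p i - p j) + Real.pi * Complex.I, fun i j hij => ?_, fun i j hij => ?_⟩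
  · dsimp only
    split_ifs
    · exact Complex.exp_log (sub_ne_zero.2 fun h => hij (hp h).symm)
    · rw [Complex.exp_add, Complex.exp_log (sub_ne_zero.2 fun h => hij (hp h)),
        Complex.exp_pi_mul_I]
      ring
  · simp [hij, hij.asymm]

lemma K33_not_disjoint {a b : Fin 3 → ℂ} (γ : ∀ i j, Path (a i) (b j)) :
    ∃ i i' j j', i ≠ i' ∧ j ≠ j' ∧ ¬ Disjoint (range (γ i j)) (range (γ i' j')) := by
  by_contra! hd
  have ha_mem : ∀ i j, a i ∈ range (γ i j) := fun i j => ⟨0, (γ i j).source⟩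
  have hb_mem : ∀ i j, b j ∈ range (γ i j) := fun i j => ⟨1, (γ i j).target⟩
  have third : ∀ i : Fin 3, ∃ j, i ≠ j := by decide
  have ha_not : ∀ i i' j', i ≠ i' → a i ∉ range (γ i' j') := fun i i' j' hi h => by
    obtain ⟨j, hj⟩ := third j'
    exact Set.disjoint_left.1 (hd i i' j j' hi hj.symm) (ha_mem i j) h
  have hb_not : ∀ j i' j', j ≠ j' → b j ∉ range (γ i' j') := fun j i' j' hj h => by
    obtain ⟨i, hi⟩ := third i'
    exact Set.disjoint_left.1 (hd i i' j j' hi.symm hj) (hb_mem i j) h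
  have ha : Function.Injective a := fun i i' h => by
    by_contra hi
    exact ha_not i i' 0 hi (by rw [h]; exact ha_mem i' 0)
  have hb : Function.Injective b := fun j j' h => by
    by_contra hj
    exact hb_not j 0 j' hj (by rw [h]; exact hb_mem 0 j')
  obtain ⟨β, hβ, hβs⟩ := exists_log_sub ha
  obtain ⟨c, hc, hcs⟩ := exists_log_sub hb
  have hab : ∀ i j, b j - a i ≠ 0 := fun i j h => by
    obtain ⟨i', hi⟩ := third i
    exact ha_not i i' j hi (sub_eq_zero.1 h ▸ hb_mem i' j)
  have hN : ∀ i i' j', ∃ n : ℤ, i ≠ i' → swept (a i) (γ i' j') =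
      Complex.log (b j' - a i) - β i i' + n * (2 * Real.pi * Complex.I) := fun i i' j' => by
    by_cases hi : i = i'
    · exact ⟨0, fun h => (h hi).elim⟩
    · obtain ⟨n, hn⟩ := exists_int_swept (γ i' j') (ha_not i i' j' hi) (hβ i i' hi)
        (Complex.exp_log (hab i j'))
      exact ⟨n, fun _ => hn⟩
  have hM : ∀ j i' j', ∃ n : ℤ, j ≠ j' → swept (b j) (γ i' j') =
      c j j' - (Complex.log (b j - a i') + Real.pi * Complex.I) +
        n * (2 * Real.pi * Complex.I) := fun j i' j' => by
    by_cases hj : j = j'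
    · exact ⟨0, fun h => (h hj).elim⟩
    · obtain ⟨n, hn⟩ := exists_int_swept (γ i' j') (hb_not j i' j' hj)
        (x := Complex.log (b j - a i') + Real.pi * Complex.I) (by
          rw [Complex.exp_add, Complex.exp_log (hab i' j), Complex.exp_pi_mul_I]; ring)
        (hc j j' hj)
      exact ⟨n, fun _ => hn⟩
  choose N hN using hN
  choose M hM using hM
  have hpi : (Real.pi : ℂ) * Complex.I ≠ 0 := by simp [Real.pi_ne_zero]
  have key : ∀ i i' j j', i < i' → j ≠ j' →
      (if j < j' then 1 else 0) + N i i' j' + M j' i j - N i' i j - M j i' j' = 0 := by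
    intro i i' j j' hi hj
    have h := swept_square (γ i j) (γ i' j') (hd i i' j j' hi.ne hj)
    rw [hN i i' j' hi.ne, hN i' i j hi.ne', hM j' i j hj.symm, hM j i' j' hj, hβs i i' hi] at h
    have : (((if j < j' then 1 else 0) + N i i' j' + M j' i j - N i' i j - M j i' j' : ℤ) : ℂ) *
        (2 * (Real.pi * Complex.I)) = 0 := by
      rcases lt_or_gt_of_ne hj with hj' | hj'
      · rw [hcs j j' hj'] at h
        simp only [hj', if_true]
        push_cast
        linear_combination h
      · rw [hcs j' j hj'] at h
        simp only [hj'.asymm, if_false]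
        push_cast
        linear_combination h
    exact_mod_cast (mul_eq_zero.1 this).resolve_right (mul_ne_zero two_ne_zero hpi)
  have k1 := fun j j' => key 0 1 j j' (by decide)
  have k2 := fun j j' => key 0 2 j j' (by decide)
  have k3 := fun j j' => key 1 2 j j' (by decide)
  simp [Fin.forall_fin_succ] at k1 k2 k3
  omega

/-- In every drawing of `K_{3,3}` in the plane by continuous paths, two independent edges meet. -/
theorem exists_independent_edges_meet {a b : Fin 3 → ℝ × ℝ} (γ : ∀ i j, Path (a i) (b j)) :
    ∃ i i' j j', i ≠ i' ∧ j ≠ j' ∧ ∃ p, p ∈ range (γ i j) ∧ p ∈ range (γ i' j') := by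
  have hφ := Complex.equivRealProdCLM.symm.continuous
  obtain ⟨i, i', j, j', hi, hj, h⟩ := K33_not_disjoint fun i j => (γ i j).map hφ
  obtain ⟨_, ⟨s, rfl⟩, t, ht⟩ := Set.not_disjoint_iff.1 h
  exact ⟨i, i', j, j', hi, hj, γ i j s, mem_range_self s, t,
    Complex.equivRealProdCLM.symm.injective ht⟩

/-- The height at abscissa `x` of the line through the points `(X u, Y u)` and `(X v, Y v)`. -/
def lineHeight {V : Type} (X Y : V → ℝ) (e : V × V) (x : ℝ) : ℝ :=
  Y e.1 + (Y e.2 - Y e.1) / (X e.2 - X e.1) * (x - X e.1)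

lemma lineHeight_fst {V : Type} (X Y : V → ℝ) (e : V × V) : lineHeight X Y e (X e.1) = Y e.1 := by
  simp [lineHeight]

lemma lineHeight_snd {V : Type} {X : V → ℝ} (Y : V → ℝ) {e : V × V} (h : X e.1 < X e.2) :
    lineHeight X Y e (X e.2) = Y e.2 := by
  have := (sub_pos.2 h).ne'
  simp only [lineHeight]
  field_simp
  ring

lemma lineHeight_neg_swap {V : Type} {X : V → ℝ} (Y : V → ℝ) {e : V × V} (h : X e.1 < X e.2)
    (x : ℝ) : lineHeight (fun v => -X v) Y e.swap x = lineHeight X Y e (-x) := by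
  have h1 := (sub_pos.2 h).ne'
  have h2 : -X e.1 - -X e.2 ≠ 0 := by linarith [sub_pos.2 h]
  simp only [lineHeight, Prod.fst_swap, Prod.snd_swap]
  rw [show -X e.1 - -X e.2 = X e.2 - X e.1 by ring]
  field_simp
  ring

/-- A finite set `E` of non-vertical straight edges, oriented from left to right, such that edges
neither cross each other nor pass through vertices. -/
structure IsPlaneEdgeSet {V : Type} (X Y : V → ℝ) (E : Finset (V × V)) : Prop where
  inj : ∀ u v, X u = X v → Y u = Y v → u = v
  lt : ∀ e ∈ E, X e.1 < X e.2
  ne_height : ∀ e ∈ E, ∀ f ∈ E, e ≠ f → ∀ x ∈ Ioo (X e.1) (X e.2), x ∈ Ioo (X f.1) (X f.2) →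
    lineHeight X Y e x ≠ lineHeight X Y f x
  ne_vertex : ∀ e ∈ E, ∀ w, X w ∈ Ioo (X e.1) (X e.2) → Y w ≠ lineHeight X Y e (X w)

/-- The vertex `w` lies above the edge `e` and sees it when looking down. -/
def SeesBelow {V : Type} (X Y : V → ℝ) (E : Finset (V × V)) (w : V) (e : V × V) : Prop :=
  X w ∈ Ioo (X e.1) (X e.2) ∧ lineHeight X Y e (X w) < Y w ∧
    ∀ g ∈ E, X w ∈ Ioo (X g.1) (X g.2) → lineHeight X Y e (X w) < lineHeight X Y g (X w) →
      Y w ≤ lineHeight X Y g (X w)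

namespace IsPlaneEdgeSet

variable {V : Type} {X Y : V → ℝ} {E : Finset (V × V)}

lemma mirror [DecidableEq V] (h : IsPlaneEdgeSet X Y E) :
    IsPlaneEdgeSet (fun v => -X v) Y (E.image Prod.swap) where
  inj u v hX hY := h.inj u v (neg_inj.1 hX) hY
  lt := by
    simp only [Finset.mem_image]
    rintro _ ⟨e, he, rfl⟩
    simpa using h.lt e he
  ne_height := by
    simp only [Finset.mem_image]
    rintro _ ⟨e, he, rfl⟩ _ ⟨f, hf, rfl⟩ hef x hx hx'
    rw [lineHeight_neg_swap Y (h.lt e he), lineHeight_neg_swap Y (h.lt f hf)]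
    simp only [Prod.fst_swap, Prod.snd_swap, mem_Ioo] at hx hx'
    exact h.ne_height e he f hf (fun hh => hef (by rw [hh])) _
      ⟨by linarith, by linarith⟩ ⟨by linarith, by linarith⟩
  ne_vertex := by
    simp only [Finset.mem_image]
    rintro _ ⟨e, he, rfl⟩ w hw
    rw [lineHeight_neg_swap Y (h.lt e he), neg_neg]
    simp only [Prod.fst_swap, Prod.snd_swap, mem_Ioo] at hw
    exact h.ne_vertex e he w ⟨by linarith, by linarith⟩

lemma seesBelow_of_mirror [DecidableEq V] (h : IsPlaneEdgeSet X Y E) {e : V × V} (he : e ∈ E)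
    {w : V} (hw : SeesBelow (fun v => -X v) Y (E.image Prod.swap) w e.swap) :
    SeesBelow X Y E w e := by
  obtain ⟨h1, h2, h3⟩ := hw
  rw [lineHeight_neg_swap Y (h.lt e he), neg_neg] at h2
  simp only [Prod.fst_swap, Prod.snd_swap, mem_Ioo] at h1
  refine ⟨⟨by linarith, by linarith⟩, h2, fun g hg hwg hlt => ?_⟩
  have := h3 g.swap (Finset.mem_image_of_mem _ hg)
    ⟨by simpa using hwg.2, by simpa using hwg.1⟩
  rw [lineHeight_neg_swap Y (h.lt e he), lineHeight_neg_swap Y (h.lt g hg), neg_neg] at this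
  exact this hlt

lemma not_swap_order (h : IsPlaneEdgeSet X Y E) {e f : V × V} (he : e ∈ E) (hf : f ∈ E)
    {x y : ℝ} (hxy : x < y) (hex : X e.1 ≤ x) (hey : y ≤ X e.2) (hfx : X f.1 ≤ x)
    (hfy : y ≤ X f.2) (h1 : lineHeight X Y e x < lineHeight X Y f x)
    (h2 : lineHeight X Y f y < lineHeight X Y e y) : False := by
  have hcont : ContinuousOn (fun z => lineHeight X Y f z - lineHeight X Y e z) (Icc x y) := by
    unfold lineHeight
    fun_prop
  obtain ⟨z, hz, hz0⟩ := intermediate_value_Ioo' hxy.le hcont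
    (show (0 : ℝ) ∈ Ioo _ _ from ⟨by linarith, by linarith⟩)
  refine h.ne_height e he f hf (fun hef => ?_) z ⟨by linarith [hz.1], by linarith [hz.2]⟩
    ⟨by linarith [hz.1], by linarith [hz.2]⟩ (by simp only at hz0; linarith)
  rw [hef] at h1
  exact h1.false

/-- If the edge following `e` upwards around its left endpoint is shorter than `e`, then
some vertex sees `e` from above. -/
lemma exists_seesBelow (h : IsPlaneEdgeSet X Y E) {e f : V × V} [Finite V] (he : e ∈ E)
    (hf : f ∈ E) (hfe : f.1 = e.1) (hlt : X f.2 < X e.2)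
    (habove : lineHeight X Y e (X f.2) < lineHeight X Y f (X f.2))
    (hnext : ∀ g ∈ E, g.1 = e.1 → ∀ x, X e.1 < x →
      lineHeight X Y e x < lineHeight X Y g x → lineHeight X Y f x ≤ lineHeight X Y g x) :
    ∃ w, SeesBelow X Y E w e := by
  have hfl := h.lt f hf
  have hel := h.lt e he
  have hf1 : lineHeight X Y f (X e.1) = Y e.1 := by rw [← hfe, lineHeight_fst]
  have he1 := lineHeight_fst X Y e
  rw [hfe] at hfl
  set S : Set V := {w | X e.1 < X w ∧ X w ≤ X f.2 ∧ lineHeight X Y e (X w) < Y w ∧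
    Y w ≤ lineHeight X Y f (X w)} with hS
  have hSne : S.Nonempty := ⟨f.2, hfl, le_rfl, by
    rw [← lineHeight_snd (X := X) Y (h.lt f hf)]; exact habove, (lineHeight_snd Y (h.lt f hf)).ge⟩
  obtain ⟨w, ⟨hw1, hw2, hw3, hw4⟩, hmin⟩ := S.toFinite.exists_minimalFor X S hSne
  refine ⟨w, ⟨hw1, by linarith⟩, hw3, fun g hg hwg hlow => ?_⟩
  by_contra! hup
  have hg1 := lineHeight_fst X Y g
  rcases lt_or_ge (X e.1) (X g.1) with hc | hc
  · have hmem : g.1 ∈ S := by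
      refine ⟨hc, by linarith [hwg.1], ?_, ?_⟩
      · by_contra! hcon
        rcases hcon.lt_or_eq with hcon | hcon
        · exact h.not_swap_order hg he hwg.1 le_rfl hwg.2.le hc.le (by linarith)
            (by linarith) hlow
        · exact h.ne_vertex e he g.1 ⟨hc, by linarith [hwg.1]⟩ hcon
      · by_contra! hcon
        exact h.not_swap_order hf hg hwg.1 (by rw [hfe]; exact hc.le) hw2 le_rfl hwg.2.le
          (by linarith) (by linarith)
    exact absurd (hmin hmem hwg.1.le) (not_le.2 hwg.1)
  · rcases lt_trichotomy (lineHeight X Y g (X e.1)) (Y e.1) with hy | hy | hy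
    · exact h.not_swap_order hg he hw1 hc hwg.2.le le_rfl (by linarith) (by linarith) hlow
    · have hge : g.1 = e.1 := by
        rcases hc.lt_or_eq with hc | hc
        · exact absurd hy.symm (h.ne_vertex g hg e.1 ⟨hc, by linarith [hwg.2]⟩)
        · exact h.inj _ _ hc (by rw [← hy, ← hc, hg1])
      linarith [hnext g hg hge _ hw1 hlow]
    · exact h.not_swap_order hf hg hw1 (by rw [hfe]) hw2 hc hwg.2.le (by linarith)
        (by linarith)

lemma lineHeight_lt_of_lt {e f : V × V} (hfe : f.1 = e.1) {x y : ℝ} (hx : X e.1 < x)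
    (hy : X e.1 < y) (hlt : lineHeight X Y e x < lineHeight X Y f x) :
    lineHeight X Y e y < lineHeight X Y f y := by
  simp only [lineHeight, hfe] at hlt ⊢
  have := lt_of_mul_lt_mul_right (lt_of_add_lt_add_left hlt) (sub_pos.2 hx).le
  have := mul_lt_mul_of_pos_right this (sub_pos.2 hy)
  linarith

lemma lineHeight_le_of_le {e f : V × V} (hfe : f.1 = e.1) {x y : ℝ} (hx : X e.1 < x)
    (hy : X e.1 < y) (hle : lineHeight X Y e x ≤ lineHeight X Y f x) :
    lineHeight X Y e y ≤ lineHeight X Y f y := by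
  by_contra! hcon
  exact absurd (lineHeight_lt_of_lt hfe.symm (by rwa [hfe]) (by rwa [hfe]) hcon) (not_lt.2 hle)

/-- Among the edges above `e` at its left endpoint there is a lowest one. -/
lemma exists_next {e : V × V}
    (hex : ∃ f ∈ E, f.1 = e.1 ∧ lineHeight X Y e (X e.1 + 1) < lineHeight X Y f (X e.1 + 1)) :
    ∃ f ∈ E, f.1 = e.1 ∧ (∀ x, X e.1 < x → lineHeight X Y e x < lineHeight X Y f x) ∧
      ∀ g ∈ E, g.1 = e.1 → ∀ x, X e.1 < x →
        lineHeight X Y e x < lineHeight X Y g x → lineHeight X Y f x ≤ lineHeight X Y g x := by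
  classical
  set S := E.filter fun f => f.1 = e.1 ∧
    lineHeight X Y e (X e.1 + 1) < lineHeight X Y f (X e.1 + 1)
  obtain ⟨f₀, hf₀, hf₀'⟩ := hex
  obtain ⟨f, hf, hmin⟩ := S.exists_min_image (fun f => lineHeight X Y f (X e.1 + 1))
    ⟨f₀, Finset.mem_filter.2 ⟨hf₀, hf₀'⟩⟩
  obtain ⟨hfE, hf1, hf2⟩ := Finset.mem_filter.1 hf
  have h1 : X e.1 < X e.1 + 1 := by linarith
  refine ⟨f, hfE, hf1, fun x hx => lineHeight_lt_of_lt hf1 h1 hx hf2, fun g hg hg1 x hx hlt => ?_⟩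
  refine lineHeight_le_of_le (hg1.trans hf1.symm) (by rwa [hf1]) (by rwa [hf1]) (hmin g ?_)
  exact Finset.mem_filter.2 ⟨hg, hg1, lineHeight_lt_of_lt hg1 hx h1 hlt⟩

/-- The edges that are uppermost among the edges leaving their left endpoint. -/
def topEdges (X Y : V → ℝ) (E : Finset (V × V)) : Finset (V × V) :=
  open Classical in E.filter fun e => ¬ ∃ f ∈ E, f.1 = e.1 ∧
    lineHeight X Y e (X e.1 + 1) < lineHeight X Y f (X e.1 + 1)

lemma card_topEdges_le [Fintype V] (h : IsPlaneEdgeSet X Y E) :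
    (topEdges X Y E).card ≤ Fintype.card V := by
  classical
  refine Finset.card_le_card_of_injOn (t := Finset.univ) Prod.fst (by simp) ?_
  intro e he f hf hef
  simp only [topEdges, Finset.coe_filter, mem_ofPred_eq, not_exists, not_and, not_lt] at he hf
  change e.1 = f.1 at hef
  have h1 := he.2 f hf.1 hef.symm
  have h2 := hf.2 e he.1 hef
  rw [← hef] at h2
  have heq := le_antisymm h1 h2
  by_contra hne
  have hle := h.lt e he.1
  have hlf := h.lt f hf.1
  obtain ⟨x, hx1, hx2⟩ := exists_between (lt_min hle (hef ▸ hlf))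
  have hX : X e.1 < X e.1 + 1 := by linarith
  refine h.ne_height e he.1 f hf.1 hne x ⟨hx1, hx2.trans_le (min_le_left _ _)⟩
    ⟨hef ▸ hx1, hx2.trans_le (min_le_right _ _)⟩ (le_antisymm ?_ ?_)
  · exact lineHeight_le_of_le hef.symm hX hx1 heq.ge
  · exact lineHeight_le_of_le hef (hef ▸ hX) (hef ▸ hx1) heq.le

lemma card_seen_le [Fintype V] (h : IsPlaneEdgeSet X Y E) {S : Finset (V × V)} (hS : S ⊆ E)
    (hw : ∀ e ∈ S, ∃ w, SeesBelow X Y E w e) : S.card ≤ Fintype.card V := by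
  classical
  rcases S.eq_empty_or_nonempty with rfl | ⟨e₀, he₀⟩
  · simp
  have : Nonempty V := ⟨e₀.1⟩
  choose! w hw using hw
  refine Finset.card_le_card_of_injOn (t := Finset.univ) w (by simp) ?_
  intro e he f hf hef
  by_contra hne
  obtain ⟨h1, h2, h3⟩ := hw e he
  obtain ⟨k1, k2, k3⟩ := hw f hf
  rw [← hef] at k1 k2 k3
  rcases lt_or_gt_of_ne (h.ne_height e (hS he) f (hS hf) hne _ h1 k1) with hlt | hlt
  · linarith [h3 f (hS hf) k1 hlt]
  · linarith [k3 e (hS he) h1 hlt]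

/-- A plane straight-line graph on `n` vertices has at most `3 n` edges. -/
theorem card_le [Fintype V] (h : IsPlaneEdgeSet X Y E) : E.card ≤ 3 * Fintype.card V := by
  classical
  set L := topEdges X Y E
  set R := (topEdges (fun v => -X v) Y (E.image Prod.swap)).image Prod.swap
  have hL : L.card ≤ Fintype.card V := h.card_topEdges_le
  have hR : R.card ≤ Fintype.card V := Finset.card_image_le.trans h.mirror.card_topEdges_le
  have hH := h.card_seen_le (S := E \ (L ∪ R)) Finset.sdiff_subset ?_
  · have h1 := Finset.card_le_card (show E ⊆ (L ∪ R) ∪ E \ (L ∪ R) from fun e he => by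
      by_cases hh : e ∈ L ∪ R <;> simp_all)
    have h2 := Finset.card_union_le (L ∪ R) (E \ (L ∪ R))
    have h3 := Finset.card_union_le L R
    omega
  intro e he
  simp only [Finset.mem_sdiff, Finset.mem_union, not_or] at he
  obtain ⟨heE, heL, heR⟩ := he
  have hel := h.lt e heE
  have hes : e.swap ∈ E.image Prod.swap := Finset.mem_image_of_mem _ heE
  obtain ⟨f, hf, hf1, hf2, hf3⟩ := exists_next (e := e) (by
    by_contra hcon
    exact heL (Finset.mem_filter.2 ⟨heE, hcon⟩))
  obtain ⟨g, hg, hg1, hg2, hg3⟩ := exists_next (X := fun v => -X v) (Y := Y)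
    (E := E.image Prod.swap) (e := e.swap) (by
    by_contra hcon
    exact heR (Finset.mem_image.2 ⟨e.swap, Finset.mem_filter.2 ⟨hes, hcon⟩, by simp⟩))
  by_cases hfe : X f.2 < X e.2
  · exact h.exists_seesBelow heE hf hf1 hfe (hf2 _ (by rw [← hf1]; exact h.lt f hf)) hf3
  by_cases hge : -X g.2 < -X e.swap.2
  · obtain ⟨w, hw⟩ := h.mirror.exists_seesBelow hes hg hg1 hge
      (hg2 _ (by rw [← hg1]; exact h.mirror.lt g hg)) hg3
    exact ⟨w, h.seesBelow_of_mirror heE hw⟩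
  exfalso
  obtain ⟨k, hk, rfl⟩ := Finset.mem_image.1 hg
  simp only [Prod.fst_swap, Prod.snd_swap] at hg1 hge hg2
  have hek := h.lt k hk
  have hg2' : ∀ x, x < X e.2 → lineHeight X Y e x < lineHeight X Y k x := fun x hx => by
    have := hg2 (-x) (by linarith)
    rwa [lineHeight_neg_swap Y hel, lineHeight_neg_swap Y hek, neg_neg] at this
  refine h.not_swap_order hf hk hel (by rw [hf1]) (not_lt.1 hfe) (by linarith) (by rw [hg1]) ?_ ?_
  · have := hg2' _ hel
    rwa [lineHeight_fst, ← hf1, ← lineHeight_fst X Y f, hf1] at this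
  · have := hf2 _ hel
    rwa [lineHeight_snd Y hel, ← hg1, ← lineHeight_snd (X := X) Y hek, hg1] at this

end IsPlaneEdgeSet

lemma eq_zero_of_parallel_of_perp {a b c d r : ℝ} (h1 : a = r * c) (h2 : b = r * d)
    (h3 : a * c + b * d = 0) : a = 0 ∧ b = 0 := by
  have h4 : a * a + b * b = 0 := by linear_combination a * h1 + b * h2 + r * h3
  exact ⟨by nlinarith [mul_self_nonneg a, mul_self_nonneg b],
    by nlinarith [mul_self_nonneg a, mul_self_nonneg b]⟩

namespace Drawing

variable {V : Type} {G : SimpleGraph V} {Γ : Drawing G}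

lemma mem_img_iff (Γ : Drawing G) {u v : V} {p : ℝ × ℝ} :
    p ∈ Γ.img s(u, v) ↔ ∃ t ∈ Icc (0 : ℝ) 1, Γ.arc u v t = p := Iff.rfl

lemma IsStraight.mem_img_iff (hΓ : Γ.IsStraight) {u v : V} (h : G.Adj u v) {p : ℝ × ℝ} :
    p ∈ Γ.img s(u, v) ↔ ∃ t ∈ Icc (0 : ℝ) 1,
      (1 - t) • Γ.vpos u + t • Γ.vpos v = p := by
  rw [Γ.mem_img_iff]
  exact exists_congr fun t => and_congr_right fun ht => by rw [hΓ u v h t ht]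

lemma Crossing.symm {e f : Sym2 V} {p : ℝ × ℝ} (h : Γ.Crossing e f p) : Γ.Crossing f e p :=
  ⟨h.2.1, h.1, h.2.2.1.symm, h.2.2.2.2.1, h.2.2.2.1, h.2.2.2.2.2⟩

lemma finite_setOf_crossing (Γ : Drawing G) (e f : Sym2 V) : {p | Γ.Crossing e f p}.Finite := by
  by_cases h : e ∈ G.edgeSet ∧ f ∈ G.edgeSet ∧ e ≠ f
  · obtain ⟨he, hf, hef⟩ := h
    induction e with | _ u v
    induction f with | _ w z
    exact (Γ.inter_finite u v w z he hf hef).subset fun p hp => ⟨hp.2.2.2.1, hp.2.2.2.2.1⟩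
  · exact Set.finite_empty.subset fun p hp => h ⟨hp.1, hp.2.1, hp.2.2.1⟩

lemma finite_crossingSet [Finite V] (Γ : Drawing G) : Γ.crossingSet.Finite := by
  have : Γ.crossingSet = ⋃ x : Sym2 V × Sym2 V, {p | Γ.Crossing x.1 x.2 p} := by
    ext p
    simp [crossingSet]
  rw [this]
  exact Set.finite_iUnion fun x => Γ.finite_setOf_crossing x.1 x.2

/-- In a straight-line RAC drawing, two edges cross at most once. -/
lemma IsRAC.crossing_unique (hΓ : Γ.IsRAC) {e f : Sym2 V} {p q : ℝ × ℝ}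
    (hp : Γ.Crossing e f p) (hq : Γ.Crossing e f q) : p = q := by
  induction e with | _ u v
  induction f with | _ w z
  have he : G.Adj u v := hp.1
  have hf : G.Adj w z := hp.2.1
  have hperp := hΓ.2 u v w z he hf ⟨p, hp⟩
  obtain ⟨-, -, -, hp1, hp2, -⟩ := hp
  obtain ⟨-, -, -, hq1, hq2, -⟩ := hq
  rw [hΓ.1.mem_img_iff he] at hp1 hq1
  rw [hΓ.1.mem_img_iff hf] at hp2 hq2
  obtain ⟨t, -, rfl⟩ := hp1
  obtain ⟨t', -, rfl⟩ := hq1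
  obtain ⟨s, -, hs⟩ := hp2
  obtain ⟨s', -, hs'⟩ := hq2
  simp only [Prod.ext_iff, Prod.fst_add, Prod.snd_add, Prod.smul_fst, Prod.smul_snd, smul_eq_mul,
    Prod.fst_sub, Prod.snd_sub] at hs hs' hperp ⊢
  obtain ⟨h5, h6⟩ := eq_zero_of_parallel_of_perp
    (a := (t - t') * ((Γ.vpos v).1 - (Γ.vpos u).1)) (b := (t - t') * ((Γ.vpos v).2 - (Γ.vpos u).2))
    (c := (Γ.vpos z).1 - (Γ.vpos w).1) (d := (Γ.vpos z).2 - (Γ.vpos w).2) (r := s - s')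
    (by linear_combination hs'.1 - hs.1) (by linear_combination hs'.2 - hs.2)
    (by linear_combination (t - t') * hperp)
  exact ⟨by linear_combination h5, by linear_combination h6⟩

lemma mem_img_of_lineHeight (hΓ : Γ.IsStraight) {X Y : V → ℝ} {φ : ℝ × ℝ → ℝ × ℝ}
    (hφ : ∀ t : ℝ, ∀ u v : V, φ ((1 - t) • (X u, Y u) + t • (X v, Y v)) =
      (1 - t) • Γ.vpos u + t • Γ.vpos v) {e : V × V} (he : G.Adj e.1 e.2) {x : ℝ}
    (hx : x ∈ Ioo (X e.1) (X e.2)) :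
    ∃ t ∈ Ioo (0 : ℝ) 1, Γ.arc e.1 e.2 t = φ (x, lineHeight X Y e x) := by
  have hlt : 0 < X e.2 - X e.1 := by linarith [hx.1, hx.2]
  have ht : (x - X e.1) / (X e.2 - X e.1) ∈ Ioo (0 : ℝ) 1 :=
    ⟨div_pos (by linarith [hx.1]) hlt, by rw [div_lt_one hlt]; linarith [hx.2]⟩
  refine ⟨_, ht, ?_⟩
  rw [hΓ _ _ he _ (Ioo_subset_Icc_self ht), ← hφ]
  congr 1
  have := hlt.ne'
  ext
  · simp
    field_simp
    ring
  · simp [lineHeight]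
    field_simp
    ring

/-- Pairwise noncrossing edges of a straight-line drawing form a plane edge set, in every
orthogonal system of coordinates in which none of them is vertical. -/
lemma IsStraight.isPlaneEdgeSet (hΓ : Γ.IsStraight) {X Y : V → ℝ} {φ : ℝ × ℝ → ℝ × ℝ}
    (hφ : ∀ t : ℝ, ∀ u v : V, φ ((1 - t) • (X u, Y u) + t • (X v, Y v)) =
      (1 - t) • Γ.vpos u + t • Γ.vpos v) {E : Finset (V × V)}
    (hadj : ∀ e ∈ E, G.Adj e.1 e.2) (hlt : ∀ e ∈ E, X e.1 < X e.2)
    (hE : ∀ e ∈ E, ∀ f ∈ E, ¬ Γ.Crosses s(e.1, e.2) s(f.1, f.2)) : IsPlaneEdgeSet X Y E := by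
  have hφv : ∀ v, φ (X v, Y v) = Γ.vpos v := fun v => by simpa using hφ 0 v v
  refine ⟨fun u v hX hY => Γ.vpos_inj ?_, hlt, ?_, ?_⟩
  · rw [← hφv, ← hφv, hX, hY]
  · intro e he f hf hef x hxe hxf h
    obtain ⟨t, ht, hte⟩ := mem_img_of_lineHeight hΓ hφ (hadj e he) hxe
    obtain ⟨s, hs, hsf⟩ := mem_img_of_lineHeight hΓ hφ (hadj f hf) hxf
    refine hE e he f hf ⟨φ (x, lineHeight X Y e x), hadj e he, hadj f hf, fun hs => ?_,
      ⟨t, Ioo_subset_Icc_self ht, hte⟩, ⟨s, Ioo_subset_Icc_self hs, h ▸ hsf⟩,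
      hte ▸ Γ.arc_avoids _ _ (hadj e he) t ht⟩
    rcases Sym2.eq_iff.1 hs with ⟨h1, h2⟩ | ⟨h1, h2⟩
    · exact hef (Prod.ext h1 h2)
    · have h3 := hlt e he
      rw [h1, h2] at h3
      exact h3.asymm (hlt f hf)
  · intro e he w hw h
    obtain ⟨t, ht, hte⟩ := mem_img_of_lineHeight hΓ hφ (hadj e he) hw
    exact Γ.arc_avoids _ _ (hadj e he) t ht ⟨w, by rw [hte, ← h, hφv]⟩

/-- A straight-line RAC drawing of a graph with `n` vertices has at most `(3 n) ^ 2` crossings. -/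
theorem IsRAC.crossings_le [Fintype V] (hΓ : Γ.IsRAC) :
    Γ.crossings ≤ (3 * Fintype.card V) ^ 2 := by
  classical
  set X : V → ℝ := fun v => (Γ.vpos v).1
  set Y : V → ℝ := fun v => (Γ.vpos v).2
  set R : Finset (V × V) := Finset.univ.filter fun e =>
    G.Adj e.1 e.2 ∧ X e.1 < X e.2 ∧ Y e.1 ≤ Y e.2
  set B : Finset (V × V) := Finset.univ.filter fun e =>
    G.Adj e.1 e.2 ∧ Y e.1 < Y e.2 ∧ X e.2 ≤ X e.1
  have hRR : ∀ e ∈ R, ∀ f ∈ R, ¬ Γ.Crosses s(e.1, e.2) s(f.1, f.2) := by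
    simp only [R, Finset.mem_filter, Finset.mem_univ, true_and]
    rintro e ⟨he, he1, he2⟩ f ⟨hf, hf1, hf2⟩ hc
    have := hΓ.2 _ _ _ _ he hf hc
    simp only [Prod.fst_sub, Prod.snd_sub] at this
    nlinarith [mul_pos (sub_pos.2 he1) (sub_pos.2 hf1),
      mul_nonneg (sub_nonneg.2 he2) (sub_nonneg.2 hf2)]
  have hBB : ∀ e ∈ B, ∀ f ∈ B, ¬ Γ.Crosses s(e.1, e.2) s(f.1, f.2) := by
    simp only [B, Finset.mem_filter, Finset.mem_univ, true_and]
    rintro e ⟨he, he1, he2⟩ f ⟨hf, hf1, hf2⟩ hc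
    have := hΓ.2 _ _ _ _ he hf hc
    simp only [Prod.fst_sub, Prod.snd_sub] at this
    nlinarith [mul_pos (sub_pos.2 he1) (sub_pos.2 hf1),
      mul_nonneg (sub_nonneg.2 he2) (sub_nonneg.2 hf2)]
  have hR : R.card ≤ 3 * Fintype.card V := by
    refine (hΓ.1.isPlaneEdgeSet (X := X) (Y := Y) (φ := id) (by simp [X, Y]) ?_ ?_ hRR).card_le
    · simp +contextual [R]
    · simp +contextual [R]
  have hB : B.card ≤ 3 * Fintype.card V := by
    refine (hΓ.1.isPlaneEdgeSet (X := Y) (Y := X) (φ := Prod.swap)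
      (by intros; ext <;> simp [X, Y]) ?_ ?_ hBB).card_le
    · simp +contextual [B]
    · simp +contextual [B]
  have hcover : ∀ e ∈ G.edgeSet, ∃ u v, e = s(u, v) ∧ ((u, v) ∈ R ∨ (u, v) ∈ B) := by
    intro e he
    induction e with | _ u v
    have huv : G.Adj u v := he
    have hne : ¬ (X u = X v ∧ Y u = Y v) := fun h => huv.ne (Γ.vpos_inj (Prod.ext h.1 h.2))
    simp only [R, B, Finset.mem_filter, Finset.mem_univ, true_and]
    rcases lt_trichotomy (X u) (X v) with hx | hx | hx <;>
      rcases lt_trichotomy (Y u) (Y v) with hy | hy | hy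
    · exact ⟨u, v, rfl, .inl ⟨huv, hx, hy.le⟩⟩
    · exact ⟨u, v, rfl, .inl ⟨huv, hx, hy.le⟩⟩
    · exact ⟨v, u, Sym2.eq_swap, .inr ⟨huv.symm, hy, hx.le⟩⟩
    · exact ⟨u, v, rfl, .inr ⟨huv, hy, hx.ge⟩⟩
    · exact (hne ⟨hx, hy⟩).elim
    · exact ⟨v, u, Sym2.eq_swap, .inr ⟨huv.symm, hy, hx.le⟩⟩
    · exact ⟨u, v, rfl, .inr ⟨huv, hy, hx.le⟩⟩
    · exact ⟨v, u, Sym2.eq_swap, .inl ⟨huv.symm, hx, hy.ge⟩⟩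
    · exact ⟨v, u, Sym2.eq_swap, .inl ⟨huv.symm, hx, hy.le⟩⟩
  set C : (V × V) × (V × V) → Set (ℝ × ℝ) :=
    fun x => {p | Γ.Crossing s(x.1.1, x.1.2) s(x.2.1, x.2.2) p} with hC
  have hsub : Γ.crossingSet ⊆ ⋃ x ∈ R ×ˢ B, C x := by
    rintro p ⟨e, f, h⟩
    obtain ⟨u, v, rfl, huv⟩ := hcover e h.1
    obtain ⟨w, z, rfl, hwz⟩ := hcover f h.2.1
    simp only [mem_iUnion, Finset.mem_product]
    rcases huv with huv | huv <;> rcases hwz with hwz | hwz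
    · exact (hRR _ huv _ hwz ⟨p, h⟩).elim
    · exact ⟨((u, v), (w, z)), ⟨huv, hwz⟩, h⟩
    · exact ⟨((w, z), (u, v)), ⟨hwz, huv⟩, h.symm⟩
    · exact (hBB _ huv _ hwz ⟨p, h⟩).elim
  have hCcard : ∀ x, (C x).ncard ≤ 1 := fun x =>
    (Set.ncard_le_one (Γ.finite_setOf_crossing _ _)).2 fun _ hp _ hq => hΓ.crossing_unique hp hq
  calc Γ.crossings ≤ (⋃ x ∈ R ×ˢ B, C x).ncard :=
        Set.ncard_le_ncard hsub (Set.Finite.biUnion (Finset.finite_toSet _)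
          fun x _ => Γ.finite_setOf_crossing _ _)
    _ ≤ ∑ x ∈ R ×ˢ B, (C x).ncard := Finset.set_ncard_biUnion_le _ _
    _ ≤ ∑ x ∈ R ×ˢ B, 1 := Finset.sum_le_sum fun x _ => hCcard x
    _ = R.card * B.card := by simp
    _ ≤ (3 * Fintype.card V) ^ 2 := by rw [sq]; gcongr

end Drawing

namespace Drawing

variable {V : Type} {G : SimpleGraph V}

/-- The curve drawn along a walk. -/
lemma exists_path_of_walk (Γ : Drawing G) {u v : V} (W : G.Walk u v) :
    ∃ γ : Path (Γ.vpos u) (Γ.vpos v), ∀ p ∈ range γ,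
      (∃ x ∈ W.support, Γ.vpos x = p) ∨ (p ∉ range Γ.vpos ∧ ∃ e ∈ W.edges, p ∈ Γ.img e) := by
  induction W with
  | nil => exact ⟨Path.refl _, by simp⟩
  | @cons u v w h W ih =>
    obtain ⟨γ, hγ⟩ := ih
    let α : Path (Γ.vpos u) (Γ.vpos v) :=
      { toFun := fun t => Γ.arc u v t
        continuous_toFun := continuousOn_iff_continuous_domRestrict.1 (Γ.arc_cont u v h)
        source' := Γ.arc_start u v h
        target' := Γ.arc_end u v h }
    refine ⟨α.trans γ, fun p hp => ?_⟩
    rw [Path.trans_range] at hp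
    rcases hp with ⟨t, rfl⟩ | hp
    · change (∃ x ∈ _, Γ.vpos x = Γ.arc u v t) ∨ (Γ.arc u v t ∉ _ ∧ _)
      rcases eq_or_ne (t : ℝ) 0 with h0 | h0
      · exact .inl ⟨u, by simp, by rw [h0, Γ.arc_start u v h]⟩
      rcases eq_or_ne (t : ℝ) 1 with h1 | h1
      · exact .inl ⟨v, by simp, by rw [h1, Γ.arc_end u v h]⟩
      exact .inr ⟨Γ.arc_avoids u v h t ⟨t.2.1.lt_of_ne h0.symm, t.2.2.lt_of_ne h1⟩,
        s(u, v), by simp, ⟨t, t.2, rfl⟩⟩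
    · rcases hγ p hp with ⟨x, hx, hxp⟩ | ⟨hp, e, he, hpe⟩
      · exact .inl ⟨x, by simp [hx], hxp⟩
      · exact .inr ⟨hp, e, by simp [he], hpe⟩

/-- In every drawing of a subdivision of `K₃,₃`, two independent paths cross. -/
theorem exists_independent_walks_cross (Γ : Drawing G) {a b : Fin 3 → V}
    (W : ∀ i j, G.Walk (a i) (b j))
    (hW : ∀ i i' j j', i ≠ i' → j ≠ j' → (W i j).support.Disjoint (W i' j').support) :
    ∃ i i' j j', i ≠ i' ∧ j ≠ j' ∧ ∃ e ∈ (W i j).edges, ∃ f ∈ (W i' j').edges,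
      Γ.Crosses e f := by
  choose γ hγ using fun i j => Γ.exists_path_of_walk (W i j)
  obtain ⟨i, i', j, j', hi, hj, p, hp, hp'⟩ := exists_independent_edges_meet γ
  refine ⟨i, i', j, j', hi, hj, ?_⟩
  have hd := hW i i' j j' hi hj
  rcases hγ i j p hp with ⟨x, hx, hxp⟩ | ⟨hpv, e, he, hpe⟩ <;>
    rcases hγ i' j' p hp' with ⟨x', hx', hxp'⟩ | ⟨hpv', e', he', hpe'⟩
  · exact (hd hx (Γ.vpos_inj (hxp.trans hxp'.symm) ▸ hx')).elim
  · exact (hpv' ⟨x, hxp⟩).elim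
  · exact (hpv ⟨x', hxp'⟩).elim
  · refine ⟨e, he, e', he', p, SimpleGraph.Walk.edges_subset_edgeSet _ he,
      SimpleGraph.Walk.edges_subset_edgeSet _ he', ?_, hpe, hpe', hpv⟩
    rintro rfl
    induction e with | _ x y
    exact hd (SimpleGraph.Walk.fst_mem_support_of_mem_edges _ he)
      (SimpleGraph.Walk.fst_mem_support_of_mem_edges _ he')

variable {Γ : Drawing G}

lemma Crosses.symm {e f : Sym2 V} (h : Γ.Crosses e f) : Γ.Crosses f e :=
  h.imp fun _ => Crossing.symm

/-- In a straight-line RAC drawing, no edge crosses two adjacent edges. -/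
lemma IsRAC.eq_of_crosses (hΓ : Γ.IsRAC) {g : Sym2 V} {x v v' : V} (h : Γ.Crosses s(x, v) g)
    (h' : Γ.Crosses s(x, v') g) : v = v' := by
  by_contra hne
  induction g with | _ w z
  obtain ⟨p, hp⟩ := h
  obtain ⟨p', hp'⟩ := h'
  have hv : G.Adj x v := hp.1
  have hv' : G.Adj x v' := hp'.1
  have hg : G.Adj w z := hp.2.1
  have hperp := hΓ.2 _ _ _ _ hv hg ⟨p, hp⟩
  have hperp' := hΓ.2 _ _ _ _ hv' hg ⟨p', hp'⟩
  obtain ⟨t, ht, htp⟩ := (hΓ.1.mem_img_iff hv).1 hp.2.2.2.1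
  obtain ⟨t', ht', htp'⟩ := (hΓ.1.mem_img_iff hv').1 hp'.2.2.2.1
  obtain ⟨s, -, hsp⟩ := (hΓ.1.mem_img_iff hg).1 hp.2.2.2.2.1
  obtain ⟨s', -, hsp'⟩ := (hΓ.1.mem_img_iff hg).1 hp'.2.2.2.2.1
  have hpx : p ≠ Γ.vpos x := fun h => hp.2.2.2.2.2 ⟨x, h.symm⟩
  have hpp : p = p' := by
    have e1 := hsp.trans htp.symm
    have e2 := hsp'.trans htp'.symm
    rw [← htp, ← htp']
    simp only [Prod.ext_iff, Prod.fst_add, Prod.snd_add, Prod.smul_fst, Prod.smul_snd,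
      smul_eq_mul, Prod.fst_sub, Prod.snd_sub] at e1 e2 hperp hperp' ⊢
    obtain ⟨h5, h6⟩ := eq_zero_of_parallel_of_perp
      (a := t * ((Γ.vpos v).1 - (Γ.vpos x).1) - t' * ((Γ.vpos v').1 - (Γ.vpos x).1))
      (b := t * ((Γ.vpos v).2 - (Γ.vpos x).2) - t' * ((Γ.vpos v').2 - (Γ.vpos x).2))
      (c := (Γ.vpos z).1 - (Γ.vpos w).1) (d := (Γ.vpos z).2 - (Γ.vpos w).2) (r := s - s')
      (by linear_combination e2.1 - e1.1) (by linear_combination e2.2 - e1.2)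
      (by linear_combination t * hperp - t' * hperp')
    exact ⟨by linear_combination h5, by linear_combination h6⟩
  subst hpp
  have hfin := Γ.inter_finite x v x v' hv hv' (by simpa [hv.ne, hv'.ne] using hne)
  refine ((Icc_infinite (zero_lt_one (α := ℝ))).image (f := fun r => Γ.vpos x + r • (p - Γ.vpos x))
    ?_) (hfin.subset ?_)
  · intro r _ r' _ h
    exact smul_left_injective ℝ (sub_ne_zero.2 hpx) (add_left_cancel h)
  · rintro _ ⟨r, hr, rfl⟩
    refine ⟨(hΓ.1.mem_img_iff hv).2 ⟨r * t, ⟨mul_nonneg hr.1 ht.1, mul_le_one₀ hr.2 ht.1 ht.2⟩, ?_⟩,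
      (hΓ.1.mem_img_iff hv').2 ⟨r * t', ⟨mul_nonneg hr.1 ht'.1, mul_le_one₀ hr.2 ht'.1 ht'.2⟩, ?_⟩⟩
    · rw [← htp]; module
    · rw [← htp']; module

end Drawing

/-- Greedy choice: if each `g` conflicts with at most two of the sets `P s i`, one can choose
pairwise conflict-free sets `P s (t s)` that do not conflict with `F` either. -/
lemma exists_conflict_free {E : Type*} [DecidableEq E] {m : ℕ} (C : E → E → Prop)
    (hC : ∀ e f, C e f → C f e) : ∀ (n : ℕ) (P : Fin n → Fin m → Finset E) (F : Finset E),
    (∀ s i, (P s i).card ≤ 2) → (∀ s g, {i | ∃ e ∈ P s i, C e g}.ncard ≤ 2) →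
    2 * (F.card + 2 * n) < m →
    ∃ t : Fin n → Fin m, (∀ s, ∀ e ∈ P s (t s), ∀ g ∈ F, ¬ C e g) ∧
      ∀ s r, s ≠ r → ∀ e ∈ P s (t s), ∀ g ∈ P r (t r), ¬ C e g
  | 0, _, _, _, _, _ => ⟨Fin.elim0, fun s => s.elim0, fun s => s.elim0⟩
  | n + 1, P, F, hP, hbad, hm => by
    obtain ⟨i, hi⟩ : ∃ i, i ∉ ⋃ g ∈ F, {i | ∃ e ∈ P 0 i, C e g} := by
      by_contra! h
      have h1 := Finset.set_ncard_biUnion_le F fun g => {i | ∃ e ∈ P 0 i, C e g}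
      rw [Set.eq_univ_of_forall h, Set.ncard_univ, Nat.card_fin] at h1
      have h2 := Finset.sum_le_card_nsmul F _ 2 fun g _ => hbad 0 g
      rw [smul_eq_mul] at h2
      omega
    simp only [mem_iUnion, Set.mem_ofPred_eq, not_exists, not_and] at hi
    have hcard := Finset.card_union_le F (P 0 i)
    have h0 := hP 0 i
    obtain ⟨t, ht, ht'⟩ := exists_conflict_free C hC n (fun s => P s.succ) (F ∪ P 0 i)
      (fun s => hP s.succ) (fun s => hbad s.succ) (by omega)
    refine ⟨Fin.cons i t, Fin.cases ?_ fun s => ?_, Fin.cases (Fin.cases ?_ fun r => ?_)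
      fun s => Fin.cases ?_ fun r => ?_⟩
    · exact fun e he g hg => hi g hg e he
    · exact fun e he g hg => ht s e he g (Finset.mem_union_left _ hg)
    · exact fun h => (h rfl).elim
    · exact fun _ e he g hg h => ht r g hg e (Finset.mem_union_right _ he) (hC _ _ h)
    · exact fun _ e he g hg => ht s e he g (Finset.mem_union_right _ hg)
    · exact fun h => ht' s r (fun h' => h (congrArg _ h'))

/-- The edges of the base graph. Its vertices `0`, …, `6` are the hubs, `17` is isolated, and each of
the others is replaced with a set of `ℓ` independent vertices. -/
def baseEdge : Fin 21 → Fin 18 × Fin 18 :=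
  ![(0, 3), (1, 4), (1, 6), (0, 7), (7, 5), (1, 8), (8, 5), (2, 9), (9, 3), (2, 10), (10, 4),
    (2, 11), (11, 5), (6, 12), (12, 4), (0, 13), (13, 14), (14, 4), (1, 15), (15, 16), (16, 3)]

/-- The number of vertices that replace a vertex of the base graph. -/
def blobSize (ℓ : ℕ) (b : Fin 18) : ℕ :=
  if b < 7 then 1 else if b < 17 then ℓ else 35 * ℓ + 9

abbrev BundleVertex (ℓ : ℕ) : Type := Σ b, Fin (blobSize ℓ b)

/-- The hub vertices of `K₃,₃` are `0, 1, 2` and `3, 4, 5`. There are ℓ₂-bundles between `0, 5` (blob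
`7`), `1, 5` (blob `8`), `2, 3` (blob `9`), `2, 4` (blob `10`), `2, 5` (blob `11`) and `6, 4` (blob
`12`); bundles of `ℓ` paths of length three between `0, 4` (blobs `13, 14`) and `1, 3` (blobs
`15, 16`); and the edges `0 3`, `1 4` and `1 6`. -/
def bundleGraph (ℓ : ℕ) : SimpleGraph (BundleVertex ℓ) where
  Adj u v := (∃ k, baseEdge k = (u.1, v.1) ∨ baseEdge k = (v.1, u.1)) ∧
    (u.1 < 7 ∨ v.1 < 7 ∨ (u.2 : ℕ) = v.2)
  symm := ⟨fun u v h => ⟨h.1.imp fun _ => Or.symm, by tauto⟩⟩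
  loopless := ⟨fun u h => by
    have : ∀ k, (baseEdge k).1 ≠ (baseEdge k).2 := by decide
    obtain ⟨⟨k, hk | hk⟩, -⟩ := h <;> exact this k (by rw [hk])⟩

namespace BundleGraph

variable {ℓ : ℕ}

lemma vertex_ext {u v : BundleVertex ℓ} (h1 : u.1 = v.1) (h2 : (u.2 : ℕ) = v.2) : u = v := by
  obtain ⟨b, i⟩ := u
  obtain ⟨c, j⟩ := v
  obtain rfl : b = c := h1
  obtain rfl : i = j := Fin.ext h2
  rfl

lemma card_vertex (ℓ : ℕ) : Fintype.card (BundleVertex ℓ) = 45 * ℓ + 16 := by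
  have h : ∀ b : Fin 18, blobSize ℓ b = (if b < 7 then 1 else if b < 17 then 0 else 9) +
      (if b < 7 then 0 else if b < 17 then 1 else 35) * ℓ := fun b => by
    unfold blobSize
    split_ifs <;> omega
  simp only [Fintype.card_sigma, Fintype.card_fin, h, Finset.sum_add_distrib, ← Finset.sum_mul]
  have h1 : ∑ b : Fin 18, (if b < 7 then 1 else if b < 17 then 0 else 9) = 16 := by decide
  have h2 : ∑ b : Fin 18, (if b < 7 then 0 else if b < 17 then 1 else 35) = 45 := by decide
  rw [h1, h2, add_comm]

lemma lt_blobSize (i : Fin ℓ) (b : Fin 18) (hb : 7 ≤ b) : (i : ℕ) < blobSize ℓ b := by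
  have := i.2
  unfold blobSize
  split_ifs <;> omega

/-- The hub `b`. -/
def hub (ℓ : ℕ) (b : Fin 18) (hb : b < 7 := by decide) : BundleVertex ℓ :=
  ⟨b, 0, by simp [blobSize, hb]⟩

/-- The vertex of the blob `b` on the `i`-th path of its bundle. -/
def mid (b : Fin 18) (i : Fin ℓ) (hb : 7 ≤ b := by decide) : BundleVertex ℓ :=
  ⟨b, i, lt_blobSize i b hb⟩

@[simp] lemma hub_fst (b : Fin 18) (hb : b < 7) : (hub ℓ b hb).1 = b := rfl

@[simp] lemma mid_fst (b : Fin 18) (i : Fin ℓ) (hb : 7 ≤ b) : (mid b i hb).1 = b := rfl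

@[simp] lemma mid_snd (b : Fin 18) (i : Fin ℓ) (hb : 7 ≤ b) : ((mid b i hb).2 : ℕ) = i := rfl

lemma mid_inj {b c : Fin 18} {i j : Fin ℓ} {hb : 7 ≤ b} {hc : 7 ≤ c} :
    mid b i hb = mid c j hc ↔ b = c ∧ i = j := by
  refine ⟨fun h => ⟨congrArg Sigma.fst h, Fin.ext (congrArg (fun x => (x.2 : ℕ)) h)⟩, ?_⟩
  rintro ⟨rfl, rfl⟩
  rfl

lemma hub_ne_mid {b c : Fin 18} {j : Fin ℓ} {hb : b < 7} {hc : 7 ≤ c} :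
    hub ℓ b hb ≠ mid c j hc := fun h => by
  obtain rfl : b = c := congrArg Sigma.fst h
  exact absurd hb hc.not_gt

lemma adj_hub_hub {b c : Fin 18} {hb : b < 7} {hc : c < 7}
    (h : ∃ k, baseEdge k = (b, c) ∨ baseEdge k = (c, b)) :
    (bundleGraph ℓ).Adj (hub ℓ b hb) (hub ℓ c hc) := ⟨h, .inl hb⟩

lemma adj_hub_mid {b c : Fin 18} {hb : b < 7} {hc : 7 ≤ c} (i : Fin ℓ)
    (h : ∃ k, baseEdge k = (b, c) ∨ baseEdge k = (c, b)) :
    (bundleGraph ℓ).Adj (hub ℓ b hb) (mid c i hc) := ⟨h, .inl hb⟩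

lemma adj_mid_mid {b c : Fin 18} {hb : 7 ≤ b} {hc : 7 ≤ c} (i : Fin ℓ)
    (h : ∃ k, baseEdge k = (b, c) ∨ baseEdge k = (c, b)) :
    (bundleGraph ℓ).Adj (mid b i hb) (mid c i hc) := ⟨h, .inr (.inr rfl)⟩

/-- The hubs joined by the ℓ₂-bundle with blob `7 + s`. -/
def leftHub : Fin 6 → Fin 18 := ![0, 1, 2, 2, 2, 6]

def rightHub : Fin 6 → Fin 18 := ![5, 5, 3, 4, 5, 4]

def blob : Fin 6 → Fin 18 := ![7, 8, 9, 10, 11, 12]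

lemma leftHub_lt : ∀ s, leftHub s < 7 := by decide
lemma rightHub_lt : ∀ s, rightHub s < 7 := by decide
lemma le_blob : ∀ s, 7 ≤ blob s := by decide

def thickLeft (s : Fin 6) (i : Fin ℓ) : Sym2 (BundleVertex ℓ) :=
  s(hub ℓ (leftHub s) (leftHub_lt s), mid (blob s) i (le_blob s))

def thickRight (s : Fin 6) (i : Fin ℓ) : Sym2 (BundleVertex ℓ) :=
  s(hub ℓ (rightHub s) (rightHub_lt s), mid (blob s) i (le_blob s))

open Classical in
/-- The edges of the `i`-th path of the `s`-th ℓ₂-bundle. -/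
def thickEdges (s : Fin 6) (i : Fin ℓ) : Finset (Sym2 (BundleVertex ℓ)) :=
  {thickLeft s i, thickRight s i}

open Classical in
/-- The edges of the `i`-th path of the bundle between the hubs `0` and `4`. -/
def edgesA (i : Fin ℓ) : Finset (Sym2 (BundleVertex ℓ)) :=
  {s(hub ℓ 0, mid 13 i), s(mid 13 i, mid 14 i), s(mid 14 i, hub ℓ 4)}

open Classical in
/-- The edges of the `i`-th path of the bundle between the hubs `1` and `3`. -/
def edgesB (i : Fin ℓ) : Finset (Sym2 (BundleVertex ℓ)) :=
  {s(hub ℓ 1, mid 15 i), s(mid 15 i, mid 16 i), s(mid 16 i, hub ℓ 3)}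

/-- The `i`-th path of the `s`-th ℓ₂-bundle. -/
def thickWalk (s : Fin 6) (i : Fin ℓ) :
    (bundleGraph ℓ).Walk (hub ℓ (leftHub s) (leftHub_lt s)) (hub ℓ (rightHub s) (rightHub_lt s)) :=
  .cons (v := mid (blob s) i (le_blob s)) (adj_hub_mid i (by revert s; decide))
    (.cons (adj_hub_mid i (by revert s; decide)).symm .nil)

def walkE (ℓ : ℕ) : (bundleGraph ℓ).Walk (hub ℓ 0) (hub ℓ 3) :=
  .cons (adj_hub_hub (by decide)) .nil

def walkA (i : Fin ℓ) : (bundleGraph ℓ).Walk (hub ℓ 0) (hub ℓ 4) :=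
  .cons (v := mid 13 i) (adj_hub_mid i (by decide)) (.cons (v := mid 14 i)
    (adj_mid_mid i (by decide)) (.cons (adj_hub_mid i (by decide)).symm .nil))

def walkB (i : Fin ℓ) : (bundleGraph ℓ).Walk (hub ℓ 1) (hub ℓ 3) :=
  .cons (v := mid 15 i) (adj_hub_mid i (by decide)) (.cons (v := mid 16 i)
    (adj_mid_mid i (by decide)) (.cons (adj_hub_mid i (by decide)).symm .nil))

lemma mem_edges_thickWalk {s : Fin 6} {i : Fin ℓ} {e : Sym2 (BundleVertex ℓ)} :
    e ∈ (thickWalk s i).edges ↔ e ∈ thickEdges s i := by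
  simp [thickWalk, thickEdges, thickLeft, thickRight, Sym2.eq_swap]

lemma mem_edges_walkA {i : Fin ℓ} {e : Sym2 (BundleVertex ℓ)} :
    e ∈ (walkA i).edges ↔ e ∈ edgesA i := by
  simp [walkA, edgesA]

lemma mem_edges_walkB {i : Fin ℓ} {e : Sym2 (BundleVertex ℓ)} :
    e ∈ (walkB i).edges ↔ e ∈ edgesB i := by
  simp [walkB, edgesB]

/-- A system of paths of `K₃,₃`. -/
def walks (i j : Fin ℓ) (t : Fin 6 → Fin ℓ) (W : (bundleGraph ℓ).Walk (hub ℓ 1) (hub ℓ 4)) :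
    ∀ x y : Fin 3, (bundleGraph ℓ).Walk ((![hub ℓ 0, hub ℓ 1, hub ℓ 2] : Fin 3 → _) x)
      ((![hub ℓ 3, hub ℓ 4, hub ℓ 5] : Fin 3 → _) y)
  | 0, 0 => walkE ℓ
  | 0, 1 => walkA i
  | 0, 2 => thickWalk 0 (t 0)
  | 1, 0 => walkB j
  | 1, 1 => W
  | 1, 2 => thickWalk 1 (t 1)
  | 2, 0 => thickWalk 2 (t 2)
  | 2, 1 => thickWalk 3 (t 3)
  | 2, 2 => thickWalk 4 (t 4)

/-- The blobs visited by the paths of `walks`. -/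
def visited : Fin 3 → Fin 3 → List (Fin 18) :=
  ![![[0, 3], [0, 13, 14, 4], [0, 7, 5]], ![[1, 15, 16, 3], [1, 4, 6, 12], [1, 8, 5]],
    ![[2, 9, 3], [2, 10, 4], [2, 11, 5]]]

lemma visited_disjoint : ∀ x x' y y', x ≠ x' → y ≠ y' →
    ∀ b ∈ visited x y, b ∉ visited x' y' := by decide

lemma fst_mem_of_mem_thickWalk {s : Fin 6} {i : Fin ℓ} {u : BundleVertex ℓ}
    (hu : u ∈ (thickWalk s i).support) : u.1 ∈ [leftHub s, blob s, rightHub s] := by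
  simp only [thickWalk, SimpleGraph.Walk.support_cons, SimpleGraph.Walk.support_nil,
    List.mem_cons, List.not_mem_nil, or_false] at hu
  rcases hu with rfl | rfl | rfl <;> simp

lemma fst_mem_visited {i j : Fin ℓ} {t : Fin 6 → Fin ℓ}
    {W : (bundleGraph ℓ).Walk (hub ℓ 1) (hub ℓ 4)}
    (hW : ∀ u ∈ W.support, u.1 ∈ visited 1 1) (x y : Fin 3) :
    ∀ u ∈ (walks i j t W x y).support, u.1 ∈ visited x y := by
  fin_cases x <;> fin_cases y
  · simp [walks, walkE, visited]
  · simp [walks, walkA, visited]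
  · exact fun u hu => fst_mem_of_mem_thickWalk hu
  · simp [walks, walkB, visited]
  · exact hW
  all_goals exact fun u hu => fst_mem_of_mem_thickWalk hu

/-- The position of the ℓ₂-bundles among the paths of `K₃,₃`. -/
def thickIndex : Fin 6 → Fin 3 × Fin 3 := ![(0, 2), (1, 2), (2, 0), (2, 1), (2, 2), (1, 1)]

lemma mem_edges_walks {i j : Fin ℓ} {t : Fin 6 → Fin ℓ}
    {W : (bundleGraph ℓ).Walk (hub ℓ 1) (hub ℓ 4)} {x y : Fin 3} {e : Sym2 (BundleVertex ℓ)}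
    (he : e ∈ (walks i j t W x y).edges) :
    ((x, y) = (0, 0) ∧ e = s(hub ℓ 0, hub ℓ 3)) ∨ ((x, y) = (0, 1) ∧ e ∈ edgesA i) ∨
    ((x, y) = (1, 0) ∧ e ∈ edgesB j) ∨ ((x, y) = (1, 1) ∧ e ∈ W.edges) ∨
    ∃ s, s ≠ 5 ∧ (x, y) = thickIndex s ∧ e ∈ thickEdges s (t s) := by
  have key : ∀ s, s ≠ 5 → (x, y) = thickIndex s → e ∈ (thickWalk s (t s)).edges →
      ∃ s, s ≠ 5 ∧ (x, y) = thickIndex s ∧ e ∈ thickEdges s (t s) :=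
    fun s hs hxy he => ⟨s, hs, hxy, mem_edges_thickWalk.1 he⟩
  fin_cases x <;> fin_cases y
  · exact .inl ⟨rfl, by simpa [walks, walkE] using he⟩
  · exact .inr (.inl ⟨rfl, mem_edges_walkA.1 he⟩)
  · exact .inr (.inr (.inr (.inr (key 0 (by decide) rfl he))))
  · exact .inr (.inr (.inl ⟨rfl, mem_edges_walkB.1 he⟩))
  · exact .inr (.inr (.inr (.inl ⟨rfl, he⟩)))
  · exact .inr (.inr (.inr (.inr (key 1 (by decide) rfl he))))
  · exact .inr (.inr (.inr (.inr (key 2 (by decide) rfl he))))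
  · exact .inr (.inr (.inr (.inr (key 3 (by decide) rfl he))))
  · exact .inr (.inr (.inr (.inr (key 4 (by decide) rfl he))))

/-- In every drawing, a system of paths as above has two independent paths that cross. -/
lemma exists_crossing (Γ : Drawing (bundleGraph ℓ)) (i j : Fin ℓ) (t : Fin 6 → Fin ℓ)
    (W : (bundleGraph ℓ).Walk (hub ℓ 1) (hub ℓ 4)) (hW : ∀ u ∈ W.support, u.1 ∈ visited 1 1) :
    (∃ e ∈ W.edges, Γ.Crosses e s(hub ℓ 0, hub ℓ 3)) ∨
    (∃ e ∈ edgesA i, ∃ f ∈ edgesB j, Γ.Crosses e f) ∨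
    ∃ s : Fin 6, s ≠ 5 ∧ ∃ e ∈ thickEdges s (t s), ∃ f, Γ.Crosses e f ∧
      (f = s(hub ℓ 0, hub ℓ 3) ∨ f ∈ edgesA i ∨ f ∈ edgesB j ∨ f ∈ W.edges ∨
        ∃ r, s ≠ r ∧ f ∈ thickEdges r (t r)) := by
  obtain ⟨x, x', y, y', hx, hy, e, he, f, hf, h⟩ := Γ.exists_independent_walks_cross
    (walks i j t W) fun x x' y y' hx hy u hu hu' => visited_disjoint x x' y y' hx hy u.1
      (fst_mem_visited hW x y u hu) (fst_mem_visited hW x' y' u hu')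
  have hthick : ∀ {s x x' y y' e f}, s ≠ 5 → (x, y) = thickIndex s → e ∈ thickEdges s (t s) →
      f ∈ (walks i j t W x' y').edges → x ≠ x' → Γ.Crosses e f →
      ∃ s : Fin 6, s ≠ 5 ∧ ∃ e ∈ thickEdges s (t s), ∃ f, Γ.Crosses e f ∧
      (f = s(hub ℓ 0, hub ℓ 3) ∨ f ∈ edgesA i ∨ f ∈ edgesB j ∨ f ∈ W.edges ∨
        ∃ r, s ≠ r ∧ f ∈ thickEdges r (t r)) := by
    intro s x x' y y' e f hs hxy he hf hx h
    refine ⟨s, hs, e, he, f, h, ?_⟩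
    rcases mem_edges_walks hf with h2 | h2 | h2 | h2 | ⟨r, -, hr, h2⟩
    · exact .inl h2.2
    · exact .inr (.inl h2.2)
    · exact .inr (.inr (.inl h2.2))
    · exact .inr (.inr (.inr (.inl h2.2)))
    · refine .inr (.inr (.inr (.inr ⟨r, ?_, h2⟩)))
      rintro rfl
      exact hx (congrArg Prod.fst (hxy.trans hr.symm))
  rcases mem_edges_walks he with ⟨h1, h1'⟩ | ⟨h1, h1'⟩ | ⟨h1, h1'⟩ | ⟨h1, h1'⟩ | ⟨s, hs, h1, h1'⟩
  case inr.inr.inr.inr => exact .inr (.inr (hthick hs h1 h1' hf hx h))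
  all_goals
    rcases mem_edges_walks hf with ⟨h2, h2'⟩ | ⟨h2, h2'⟩ | ⟨h2, h2'⟩ | ⟨h2, h2'⟩ | ⟨r, hr, h2, h2'⟩
    case inr.inr.inr.inr => exact .inr (.inr (hthick hr h2 h2' he hx.symm h.symm))
    all_goals
      obtain ⟨rfl, rfl⟩ := Prod.ext_iff.1 h1
      obtain ⟨rfl, rfl⟩ := Prod.ext_iff.1 h2
      first
        | exact (hx rfl).elim
        | exact (hy rfl).elim
        | skip
  · exact .inl ⟨f, h2', h1' ▸ h.symm⟩
  · exact .inr (.inl ⟨e, h1', f, h2', h⟩)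
  · exact .inr (.inl ⟨f, h2', e, h1', h.symm⟩)
  · exact .inl ⟨e, h1', h2' ▸ h⟩

/-- The edge between the hubs `1` and `4`. -/
def walkF (ℓ : ℕ) : (bundleGraph ℓ).Walk (hub ℓ 1) (hub ℓ 4) :=
  .cons (adj_hub_hub (by decide)) .nil

/-- The path from the hub `1` to the hub `4` through the hub `6`. -/
def walkF' (i : Fin ℓ) : (bundleGraph ℓ).Walk (hub ℓ 1) (hub ℓ 4) :=
  .cons (v := hub ℓ 6) (adj_hub_hub (by decide)) (thickWalk 5 i)

lemma mem_support_walkF' {i : Fin ℓ} {u : BundleVertex ℓ} (hu : u ∈ (walkF' i).support) :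
    u = hub ℓ 1 ∨ u ∈ (thickWalk 5 i).support := List.mem_cons.1 hu

lemma mem_edges_walkF' {i : Fin ℓ} {e : Sym2 (BundleVertex ℓ)} (he : e ∈ (walkF' i).edges) :
    e = s(hub ℓ 1, hub ℓ 6) ∨ e ∈ thickEdges 5 i :=
  (List.mem_cons.1 he).imp_right mem_edges_thickWalk.1

lemma one_le_crossings (hℓ : 0 < ℓ) (Γ : Drawing (bundleGraph ℓ)) : 1 ≤ Γ.crossings := by
  obtain ⟨e, f, p, h⟩ : ∃ e f, Γ.Crosses e f := by
    rcases exists_crossing Γ ⟨0, hℓ⟩ ⟨0, hℓ⟩ (fun _ => ⟨0, hℓ⟩) (walkF ℓ)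
        (by simp [walkF, visited]) with ⟨e, -, h⟩ | ⟨e, -, f, -, h⟩ | ⟨-, -, e, -, f, h, -⟩
    exacts [⟨_, _, h⟩, ⟨_, _, h⟩, ⟨_, _, h⟩]
  exact (Set.ncard_pos Γ.finite_crossingSet).2 ⟨p, e, f, h⟩

lemma ncard_bad_le {Γ : Drawing (bundleGraph ℓ)} (hΓ : Γ.IsRAC) (s : Fin 6)
    (g : Sym2 (BundleVertex ℓ)) : {i | ∃ e ∈ thickEdges s i, Γ.Crosses e g}.ncard ≤ 2 := by
  have hsub : {i | ∃ e ∈ thickEdges s i, Γ.Crosses e g} ⊆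
      {i | Γ.Crosses (thickLeft s i) g} ∪ {i | Γ.Crosses (thickRight s i) g} := by
    rintro i ⟨e, he, h⟩
    rw [thickEdges, Finset.mem_insert, Finset.mem_singleton] at he
    rcases he with rfl | rfl
    exacts [.inl h, .inr h]
  have hl : {i | Γ.Crosses (thickLeft s i) g}.ncard ≤ 1 :=
    (Set.ncard_le_one (Set.toFinite _)).2 fun i hi j hj => (mid_inj.1 (hΓ.eq_of_crosses hi hj)).2
  have hr : {i | Γ.Crosses (thickRight s i) g}.ncard ≤ 1 :=
    (Set.ncard_le_one (Set.toFinite _)).2 fun i hi j hj => (mid_inj.1 (hΓ.eq_of_crosses hi hj)).2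
  calc _ ≤ _ := Set.ncard_le_ncard hsub (Set.toFinite _)
    _ ≤ _ := Set.ncard_union_le _ _
    _ ≤ 2 := by omega

lemma exists_crosses_edgesA_edgesB (hℓ : 43 ≤ ℓ) {Γ : Drawing (bundleGraph ℓ)} (hΓ : Γ.IsRAC)
    (i j : Fin ℓ) : ∃ e ∈ edgesA i, ∃ f ∈ edgesB j, Γ.Crosses e f := by
  classical
  set E : Sym2 (BundleVertex ℓ) := s(hub ℓ 0, hub ℓ 3) with hE
  set F : Finset (Sym2 (BundleVertex ℓ)) :=
    {E, s(hub ℓ 1, hub ℓ 4), s(hub ℓ 1, hub ℓ 6)} ∪ edgesA i ∪ edgesB j with hF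
  have hFcard : F.card ≤ 9 := by
    have h1 := Finset.card_le_three (a := E) (b := s(hub ℓ 1, hub ℓ 4)) (c := s(hub ℓ 1, hub ℓ 6))
    have h2 := Finset.card_le_three (a := s(hub ℓ 0, mid 13 i)) (b := s(mid 13 i, mid 14 i))
      (c := s(mid 14 i, hub ℓ 4))
    have h3 := Finset.card_le_three (a := s(hub ℓ 1, mid 15 j)) (b := s(mid 15 j, mid 16 j))
      (c := s(mid 16 j, hub ℓ 3))
    refine (Finset.card_union_le _ _).trans ((add_le_add_left (Finset.card_union_le _ _) _).trans ?_)
    rw [edgesA, edgesB]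
    convert add_le_add (add_le_add h1 h2) h3
  obtain ⟨t, ht, ht'⟩ := exists_conflict_free Γ.Crosses (fun _ _ h => h.symm) 6
    (thickEdges (ℓ := ℓ)) F (fun s i => Finset.card_le_two) (fun s g => ncard_bad_le hΓ s g)
    (by omega)
  obtain ⟨W, hW, hWF, hWE⟩ : ∃ W : (bundleGraph ℓ).Walk (hub ℓ 1) (hub ℓ 4),
      (∀ u ∈ W.support, u.1 ∈ visited 1 1) ∧ (∀ e ∈ W.edges, e ∈ F ∨ e ∈ thickEdges 5 (t 5)) ∧
      ∀ e ∈ W.edges, ¬ Γ.Crosses e E := by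
    by_cases h : Γ.Crosses s(hub ℓ 1, hub ℓ 4) E
    · refine ⟨walkF' (t 5), ?_, ?_, ?_⟩
      · intro u hu
        rcases mem_support_walkF' hu with rfl | hu
        · simp [visited]
        · have := fst_mem_of_mem_thickWalk hu
          revert this
          generalize u.1 = b
          revert b
          decide
      · intro e he
        rcases mem_edges_walkF' he with rfl | he
        · exact .inl (by simp [hF])
        · exact .inr he
      · intro e he hc
        rcases mem_edges_walkF' he with rfl | he
        · exact (by decide : (4 : Fin 18) ≠ 6) (congrArg Sigma.fst (hΓ.eq_of_crosses h hc))
        · exact ht 5 e he E (by simp [hF]) hc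
    · refine ⟨walkF ℓ, by simp [walkF, visited], ?_, ?_⟩
      · simp [walkF, hF]
      · simpa [walkF] using h
  rcases exists_crossing Γ i j t W hW with ⟨e, he, h⟩ | h | ⟨s, hs, e, he, f, h, hf⟩
  · exact (hWE e he h).elim
  · exact h
  · suffices hf' : f ∈ F ∨ ∃ r, s ≠ r ∧ f ∈ thickEdges r (t r) by
      rcases hf' with hf | ⟨r, hr, hf⟩
      exacts [(ht s e he f hf h).elim, (ht' s r hr e he f hf h).elim]
    rcases hf with rfl | hf | hf | hf | hf
    · exact .inl (by simp [hF, hE])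
    · exact .inl (by simp [hF, hf])
    · exact .inl (by simp [hF, hf])
    · exact (hWF f hf).imp_right fun h => ⟨5, hs, h⟩
    · exact .inr hf

lemma edgesA_disjoint {i j : Fin ℓ} {e f : Sym2 (BundleVertex ℓ)} (he : e ∈ edgesA i)
    (hf : f ∈ edgesA j) (h : i ≠ j) : e ≠ f := by
  simp only [edgesA, Finset.mem_insert, Finset.mem_singleton] at he hf
  rcases he with rfl | rfl | rfl <;> rcases hf with rfl | rfl | rfl <;>
    simp [mid_inj, hub_ne_mid, hub_ne_mid.symm, h]

lemma edgesB_disjoint {i j : Fin ℓ} {e f : Sym2 (BundleVertex ℓ)} (he : e ∈ edgesB i)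
    (hf : f ∈ edgesB j) (h : i ≠ j) : e ≠ f := by
  simp only [edgesB, Finset.mem_insert, Finset.mem_singleton] at he hf
  rcases he with rfl | rfl | rfl <;> rcases hf with rfl | rfl | rfl <;>
    simp [mid_inj, hub_ne_mid, hub_ne_mid.symm, h]

lemma edgesA_ne_edgesB {i j : Fin ℓ} {e f : Sym2 (BundleVertex ℓ)} (he : e ∈ edgesA i)
    (hf : f ∈ edgesB j) : e ≠ f := by
  simp only [edgesA, edgesB, Finset.mem_insert, Finset.mem_singleton] at he hf
  rcases he with rfl | rfl | rfl <;> rcases hf with rfl | rfl | rfl <;>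
    simp [mid_inj, hub_ne_mid, hub_ne_mid.symm]

theorem sq_le_crossings (hℓ : 43 ≤ ℓ) {Γ : Drawing (bundleGraph ℓ)} (hΓ : Γ.IsRAC) :
    ℓ ^ 2 ≤ Γ.crossings := by
  choose e he f hf p hp using exists_crosses_edgesA_edgesB hℓ hΓ
  have triple : ∀ {e₁ e₂ e₃ : Sym2 (BundleVertex ℓ)} {p : ℝ × ℝ}, Γ.Crossing e₁ e₂ p →
      Γ.Crossing e₁ e₃ p → e₂ ≠ e₃ → False := by
    intro e₁ e₂ e₃ p h h' hne
    induction e₁ with | _ u₁ v₁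
    induction e₂ with | _ u₂ v₂
    induction e₃ with | _ u₃ v₃
    exact Γ.no_triple_point p h.2.2.2.2.2 _ _ _ _ _ _ h.1 h.2.1 h'.2.1 h.2.2.1 h'.2.2.1 hne
      ⟨h.2.2.2.1, h.2.2.2.2.1, h'.2.2.2.2.1⟩
  have hinj : Function.Injective fun x : Fin ℓ × Fin ℓ => p x.1 x.2 := by
    rintro ⟨i, j⟩ ⟨i', j'⟩ (h : p i j = p i' j')
    have h1 := hp i j
    have h2 := hp i' j'
    rw [← h] at h2
    by_contra hne
    by_cases hi : i = i'
    · have hj : j ≠ j' := fun hj => hne (by rw [hi, hj])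
      refine triple h1 ⟨h1.1, h2.2.1, edgesA_ne_edgesB (he i j) (hf i' j'), h1.2.2.2.1,
        h2.2.2.2.2⟩ (edgesB_disjoint (hf i j) (hf i' j') hj)
    · refine triple h1.symm ⟨h1.2.1, h2.1, (edgesA_ne_edgesB (he i' j') (hf i j)).symm,
        h1.2.2.2.2.1, h2.2.2.2.1, h2.2.2.2.2.2⟩ (edgesA_disjoint (he i j) (he i' j') hi)
  calc ℓ ^ 2 = (range fun x : Fin ℓ × Fin ℓ => p x.1 x.2).ncard := by
        rw [Set.ncard_range_of_injective hinj]; simp [sq]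
    _ ≤ Γ.crossings := Set.ncard_le_ncard
        (by rintro _ ⟨x, rfl⟩; exact ⟨_, _, hp x.1 x.2⟩) Γ.finite_crossingSet

end BundleGraph

/-- Twice the signed area of the triangle `a b c`. -/
def orient {R : Type*} [CommRing R] (a b c : R × R) : R :=
  (b.1 - a.1) * (c.2 - a.2) - (b.2 - a.2) * (c.1 - a.1)

lemma orient_swap_left {R : Type*} [CommRing R] (a b c : R × R) :
    orient b a c = - orient a b c := by
  simp only [orient]; ring

lemma orient_lineMap (a b x y : ℝ × ℝ) (t : ℝ) :
    orient a b ((1 - t) • x + t • y) = (1 - t) * orient a b x + t * orient a b y := by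
  simp only [orient, Prod.fst_add, Prod.snd_add, Prod.smul_fst, Prod.smul_snd, smul_eq_mul]
  ring

lemma mem_segment_iff {x y p : ℝ × ℝ} :
    p ∈ segment ℝ x y ↔ ∃ t ∈ Icc (0 : ℝ) 1, (1 - t) • x + t • y = p := by
  rw [segment_eq_image]; rfl

lemma orient_eq_zero_of_mem_segment {a b p : ℝ × ℝ} (h : p ∈ segment ℝ a b) :
    orient a b p = 0 := by
  obtain ⟨t, -, rfl⟩ := mem_segment_iff.1 h
  rw [orient_lineMap]
  simp only [orient]
  ring

lemma eq_of_mem_segment {a b c d p q : ℝ × ℝ} (h : orient a b c ≠ 0) (hp : p ∈ segment ℝ a b)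
    (hp' : p ∈ segment ℝ c d) (hq : q ∈ segment ℝ a b) (hq' : q ∈ segment ℝ c d) : p = q := by
  have h1 := orient_eq_zero_of_mem_segment hp
  have h2 := orient_eq_zero_of_mem_segment hq
  obtain ⟨t, -, rfl⟩ := mem_segment_iff.1 hp'
  obtain ⟨s, -, rfl⟩ := mem_segment_iff.1 hq'
  rw [orient_lineMap] at h1 h2
  have h3 : (t - s) * orient a b c = 0 := by linear_combination t * h2 - s * h1
  rw [sub_eq_zero.1 ((mul_eq_zero.1 h3).resolve_right h)]

lemma disjoint_segment_of_orient {a b c d : ℝ × ℝ} (h : 0 < orient a b c * orient a b d) :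
    Disjoint (segment ℝ a b) (segment ℝ c d) := by
  refine Set.disjoint_left.2 fun p hp hp' => ?_
  have h1 := orient_eq_zero_of_mem_segment hp
  obtain ⟨t, ht, rfl⟩ := mem_segment_iff.1 hp'
  rw [orient_lineMap] at h1
  rcases pos_and_pos_or_neg_and_neg_of_mul_pos h with ⟨hc, hd⟩ | ⟨hc, hd⟩
  · nlinarith [mul_nonneg ht.1 hd.le, mul_nonneg (sub_nonneg.2 ht.2) hc.le, ht.1, ht.2]
  · nlinarith [mul_nonneg ht.1 (neg_pos.2 hd).le, mul_nonneg (sub_nonneg.2 ht.2) (neg_pos.2 hc).le,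
      ht.1, ht.2]

/-- A straight-line drawing is determined by the positions of the vertices. -/
theorem exists_straight_drawing {V : Type} {G : SimpleGraph V} {pos : V → ℝ × ℝ}
    (hinj : Function.Injective pos)
    (hpos : ∀ u v x, G.Adj u v → x ≠ u → x ≠ v → orient (pos u) (pos v) (pos x) ≠ 0)
    {R : Sym2 V → Sym2 V → Prop}
    (hR : ∀ u v w z, G.Adj u v → G.Adj w z → u ≠ w → u ≠ z → v ≠ w → v ≠ z →
      ¬ Disjoint (segment ℝ (pos u) (pos v)) (segment ℝ (pos w) (pos z)) → R s(u, v) s(w, z))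
    (hR' : ∀ e f g, R e f → R e g → R f g → False) :
    ∃ Γ : Drawing G, Γ.IsStraight ∧ Γ.vpos = pos ∧ (∀ e f p, Γ.Crossing e f p → R e f) ∧
      ∀ e f, {p | Γ.Crossing e f p}.Subsingleton := by
  have uniq : ∀ {u v w z p q}, G.Adj u v → G.Adj w z → s(u, v) ≠ s(w, z) →
      p ∈ segment ℝ (pos u) (pos v) → p ∈ segment ℝ (pos w) (pos z) →
      q ∈ segment ℝ (pos u) (pos v) → q ∈ segment ℝ (pos w) (pos z) → p = q := by
    intro u v w z p q huv hwz hne hp hp' hq hq'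
    by_cases hw : w ≠ u ∧ w ≠ v
    · exact eq_of_mem_segment (hpos u v w huv hw.1 hw.2) hp hp' hq hq'
    · refine eq_of_mem_segment (hpos u v z huv ?_ ?_) hp (segment_symm ℝ (pos w) _ ▸ hp') hq
        (segment_symm ℝ (pos w) _ ▸ hq')
      · rintro rfl
        have hwv : w = v := by
          by_contra h
          exact hw ⟨hwz.ne, h⟩
        exact hne (hwv ▸ Sym2.eq_swap)
      · rintro rfl
        have hwu : w = u := by
          by_contra h
          exact hw ⟨h, hwz.ne⟩
        exact hne (by rw [hwu])
  have cross : ∀ {u v w z p}, G.Adj u v → G.Adj w z → s(u, v) ≠ s(w, z) →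
      p ∈ segment ℝ (pos u) (pos v) → p ∈ segment ℝ (pos w) (pos z) → p ∉ range pos →
      R s(u, v) s(w, z) := by
    intro u v w z p huv hwz hne hp hp' hpv
    have key : ∀ x, pos x ∈ segment ℝ (pos u) (pos v) → pos x ∈ segment ℝ (pos w) (pos z) → False :=
      fun x hx hx' => hpv ⟨x, (uniq huv hwz hne hp hp' hx hx').symm⟩
    refine hR u v w z huv hwz ?_ ?_ ?_ ?_ fun h => Set.disjoint_left.1 h hp hp'
    · rintro rfl
      exact key u (left_mem_segment ..) (left_mem_segment ..)
    · rintro rfl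
      exact key u (left_mem_segment ..) (right_mem_segment ..)
    · rintro rfl
      exact key v (right_mem_segment ..) (left_mem_segment ..)
    · rintro rfl
      exact key v (right_mem_segment ..) (right_mem_segment ..)
  have himg : ∀ u v, (fun t : ℝ => (1 - t) • pos u + t • pos v) '' Icc 0 1 =
      segment ℝ (pos u) (pos v) := fun u v => (segment_eq_image ..).symm
  let Γ : Drawing G :=
    { vpos := pos
      vpos_inj := hinj
      arc := fun u v t => (1 - t) • pos u + t • pos v
      arc_symm := fun u v t => by simp only [sub_sub_cancel]; exact add_comm _ _
      arc_cont := fun u v _ => by fun_prop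
      arc_injOn := fun u v h t _ s _ hts => by
        have h1 : (t - s) • (pos v - pos u) = 0 := by
          have : (1 - t) • pos u + t • pos v = (1 - s) • pos u + s • pos v := hts
          linear_combination (norm := module) this
        exact sub_eq_zero.1 ((smul_eq_zero.1 h1).resolve_right
          (sub_ne_zero.2 (hinj.ne h.ne')))
      arc_start := fun u v _ => by simp
      arc_end := fun u v _ => by simp
      arc_avoids := by
        rintro u v h t ht ⟨x, hx⟩
        by_cases hxu : x = u
        · have h1 : t • (pos v - pos u) = 0 := by
            rw [hxu] at hx
            linear_combination (norm := module) -hx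
          exact ((smul_eq_zero.1 h1).resolve_left ht.1.ne') |> sub_eq_zero.1 |> hinj.ne h.ne'
        by_cases hxv : x = v
        · have h1 : (1 - t) • (pos v - pos u) = 0 := by
            rw [hxv] at hx
            linear_combination (norm := module) hx
          exact ((smul_eq_zero.1 h1).resolve_left (sub_pos.2 ht.2).ne') |> sub_eq_zero.1 |>
            hinj.ne h.ne'
        exact hpos u v x h hxu hxv (orient_eq_zero_of_mem_segment
          (mem_segment_iff.2 ⟨t, Ioo_subset_Icc_self ht, hx.symm⟩))
      inter_finite := fun u v w z huv hwz hne => by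
        rw [himg, himg]
        exact Set.Subsingleton.finite fun p hp q hq => uniq huv hwz hne hp.1 hp.2 hq.1 hq.2
      no_triple_point := by
        rintro p hp u₁ v₁ u₂ v₂ u₃ v₃ h₁ h₂ h₃ h₁₂ h₁₃ h₂₃ ⟨hp₁, hp₂, hp₃⟩
        rw [himg] at hp₁ hp₂ hp₃
        exact hR' _ _ _ (cross h₁ h₂ h₁₂ hp₁ hp₂ hp) (cross h₁ h₃ h₁₃ hp₁ hp₃ hp)
          (cross h₂ h₃ h₂₃ hp₂ hp₃ hp) }
  refine ⟨Γ, fun u v _ t _ => rfl, rfl, fun e f p h => ?_, fun e f p h q h' => ?_⟩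
  all_goals
    induction e with | _ u v
    induction f with | _ w z
    obtain ⟨he, hf, hef, hp, hp', hpv⟩ := h
  · exact cross he hf hef (himg u v ▸ hp) (himg w z ▸ hp') hpv
  · exact uniq he hf hef (himg u v ▸ hp) (himg w z ▸ hp') (himg u v ▸ h'.2.2.2.1)
      (himg w z ▸ h'.2.2.2.2.1)

/-- The real point `a'` is close to the integer point `a`. -/
structure IsNear (a : ℤ × ℤ) (a' : ℝ × ℝ) : Prop where
  fst_le : |(a.1 : ℝ)| ≤ 50
  snd_le : |(a.2 : ℝ)| ≤ 50
  fst_near : |a'.1 - a.1| ≤ 1 / 1000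
  snd_near : |a'.2 - a.2| ≤ 1 / 1000

/-- The orientation of integer points is not changed by small perturbations. -/
lemma orient_pos_of_isNear {a b c : ℤ × ℤ} {a' b' c' : ℝ × ℝ} (ha : IsNear a a')
    (hb : IsNear b b') (hc : IsNear c c') (h : 0 < orient a b c) : 0 < orient a' b' c' := by
  have hmul : ∀ {x e y f : ℝ}, |x| ≤ 100 → |e| ≤ 1 / 500 → |y| ≤ 100 → |f| ≤ 1 / 500 →
      |(x + e) * (y + f) - x * y| ≤ 9 / 20 := by
    intro x e y f hx he hy hf
    have h1 : |x * f| ≤ 100 * (1 / 500) := by rw [abs_mul]; gcongr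
    have h2 : |e * y| ≤ 1 / 500 * 100 := by rw [abs_mul]; gcongr
    have h3 : |e * f| ≤ 1 / 500 * (1 / 500) := by rw [abs_mul]; gcongr
    rw [abs_le] at *
    constructor <;> nlinarith
  have hsub : ∀ {x y : ℝ}, |x| ≤ 50 → |y| ≤ 50 → |x - y| ≤ 100 := fun hx hy => by
    rw [abs_le] at *
    constructor <;> linarith
  have herr : ∀ {x y x' y' : ℝ}, |x' - x| ≤ 1 / 1000 → |y' - y| ≤ 1 / 1000 →
      |(x' - y') - (x - y)| ≤ 1 / 500 := fun hx hy => by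
    rw [abs_le] at *
    constructor <;> linarith
  have h1 := hmul (hsub hb.1 ha.1) (herr hb.3 ha.3) (hsub hc.2 ha.2) (herr hc.4 ha.4)
  have h2 := hmul (hsub hb.2 ha.2) (herr hb.4 ha.4) (hsub hc.1 ha.1) (herr hc.3 ha.3)
  have h0 : (1 : ℝ) ≤ (b.1 - a.1) * (c.2 - a.2) - (b.2 - a.2) * (c.1 - a.1) := by
    exact_mod_cast h
  simp only [add_sub_cancel] at h1 h2
  rw [abs_le] at h1 h2
  unfold orient
  linarith

lemma orient_neg_of_isNear {a b c : ℤ × ℤ} {a' b' c' : ℝ × ℝ} (ha : IsNear a a')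
    (hb : IsNear b b') (hc : IsNear c c') (h : orient a b c < 0) : orient a' b' c' < 0 := by
  have := orient_pos_of_isNear hb ha hc (by rw [orient_swap_left]; exact neg_pos.2 h)
  rw [orient_swap_left] at this
  exact neg_pos.1 this

lemma orient_ne_zero_of_isNear {a b c : ℤ × ℤ} {a' b' c' : ℝ × ℝ} (ha : IsNear a a')
    (hb : IsNear b b') (hc : IsNear c c') (h : orient a b c ≠ 0) : orient a' b' c' ≠ 0 :=
  h.lt_or_gt.elim (fun h => (orient_neg_of_isNear ha hb hc h).ne)
    fun h => (orient_pos_of_isNear ha hb hc h).ne'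

lemma orient_mul_pos_of_isNear {a b c d : ℤ × ℤ} {a' b' c' d' : ℝ × ℝ} (ha : IsNear a a')
    (hb : IsNear b b') (hc : IsNear c c') (hd : IsNear d d')
    (h : 0 < orient a b c * orient a b d) : 0 < orient a' b' c' * orient a' b' d' := by
  rcases pos_and_pos_or_neg_and_neg_of_mul_pos h with ⟨h1, h2⟩ | ⟨h1, h2⟩
  · exact mul_pos (orient_pos_of_isNear ha hb hc h1) (orient_pos_of_isNear ha hb hd h2)
  · exact mul_pos_of_neg_of_neg (orient_neg_of_isNear ha hb hc h1)
      (orient_neg_of_isNear ha hb hd h2)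

lemma orient_mul_neg_of_isNear {a b c d : ℤ × ℤ} {a' b' c' d' : ℝ × ℝ} (ha : IsNear a a')
    (hb : IsNear b b') (hc : IsNear c c') (hd : IsNear d d')
    (h : orient a b c * orient a b d < 0) : orient a' b' c' * orient a' b' d' < 0 := by
  rcases mul_neg_iff.1 h with ⟨h1, h2⟩ | ⟨h1, h2⟩
  · exact mul_neg_of_pos_of_neg (orient_pos_of_isNear ha hb hc h1)
      (orient_neg_of_isNear ha hb hd h2)
  · exact mul_neg_of_neg_of_pos (orient_neg_of_isNear ha hb hc h1)
      (orient_pos_of_isNear ha hb hd h2)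

def realPoint (a : ℤ × ℤ) : ℝ × ℝ := (a.1, a.2)

namespace BundleGraph

variable {ℓ : ℕ}

/-- The edges of the base graph with both orientations. -/
def baseArc (d : Fin 21 × Bool) : Fin 18 × Fin 18 :=
  if d.2 then baseEdge d.1 else (baseEdge d.1).swap

/-- A straight-line drawing of the base graph in which only the pairs of edges in `C` may cross,
and for each blob `b` a direction `w b` in which its vertices can be spread. -/
structure IsLayout (P w : Fin 18 → ℤ × ℤ) (C : List (Fin 21 × Fin 21)) : Prop where
  inj : ∀ b c, P b = P c → b = c
  P_le : ∀ b, (-40 ≤ (P b).1 ∧ (P b).1 ≤ 40) ∧ -40 ≤ (P b).2 ∧ (P b).2 ≤ 40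
  w_le : ∀ b, (-1 ≤ (w b).1 ∧ (w b).1 ≤ 1) ∧ -1 ≤ (w b).2 ∧ (w b).2 ≤ 1
  w_ne : ∀ b, 7 ≤ b → w b ≠ 0
  orient_ne : ∀ k b, b ≠ (baseEdge k).1 → b ≠ (baseEdge k).2 →
    orient (P (baseEdge k).1) (P (baseEdge k).2) (P b) ≠ 0
  side_ne : ∀ d, 7 ≤ (baseArc d).1 →
    orient (P (baseArc d).1) (P (baseArc d).1 + w (baseArc d).1) (P (baseArc d).2) ≠ 0
  side_mul : ∀ d d', (baseArc d').1 = (baseArc d).1 → 7 ≤ (baseArc d).1 →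
    (baseArc d).2 ≠ (baseArc d').2 →
    orient (P (baseArc d).1) (P (baseArc d).1 + w (baseArc d).1) (P (baseArc d).2) *
      orient (P (baseArc d).1) (P (baseArc d).1 + w (baseArc d).1) (P (baseArc d').2) < 0
  w_eq : ∀ k, 7 ≤ (baseEdge k).1 → 7 ≤ (baseEdge k).2 → w (baseEdge k).1 = w (baseEdge k).2
  sides : ∀ k l, (baseEdge k).1 ≠ (baseEdge l).1 → (baseEdge k).1 ≠ (baseEdge l).2 →
    (baseEdge k).2 ≠ (baseEdge l).1 → (baseEdge k).2 ≠ (baseEdge l).2 → (k, l) ∈ C ∨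
    0 < orient (P (baseEdge k).1) (P (baseEdge k).2) (P (baseEdge l).1) *
      orient (P (baseEdge k).1) (P (baseEdge k).2) (P (baseEdge l).2) ∨
    0 < orient (P (baseEdge l).1) (P (baseEdge l).2) (P (baseEdge k).1) *
      orient (P (baseEdge l).1) (P (baseEdge l).2) (P (baseEdge k).2)
  triple : ∀ x ∈ C, ∀ y ∈ C, x.1 = y.1 → (x.2, y.2) ∉ C

lemma isLayout_rac : IsLayout
    ![(-10, 0), (0, -10), (12, 13), (0, 10), (10, 0), (-12, -12), (13, -3), (-12, -6), (-6, -13),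
      (6, 12), (13, 6), (-20, 20), (12, -1), (-4, 1), (5, 1), (1, -4), (1, 5), (40, 3)]
    ![0, 0, 0, 0, 0, 0, 0, (1, 0), (0, 1), (0, 1), (1, 0), (1, -1), (1, 0), (0, 1), (0, 1), (1, 0),
      (1, 0), (1, 0)] [(16, 19), (19, 16)] where
  inj := by decide +kernel
  P_le := by decide +kernel
  w_le := by decide +kernel
  w_ne := by decide +kernel
  orient_ne := by decide +kernel
  side_ne := by decide +kernel
  side_mul := by decide +kernel
  w_eq := by decide +kernel
  sides := by decide +kernel
  triple := by decide +kernel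

lemma isLayout_two : IsLayout
    ![(-11, 0), (0, -10), (11, 14), (11, 0), (0, 10), (-12, -12), (2, 4), (-12, -6), (-6, -13),
      (13, 5), (7, 12), (-20, 19), (3, 9), (-8, 4), (-2, 8), (5, -9), (8, -3), (40, 3)]
    ![0, 0, 0, 0, 0, 0, 0, (1, 0), (0, 1), (1, 0), (0, 1), (1, -1), (1, 0), (1, -1), (1, -1),
      (1, -1), (1, -1), (1, 0)] [(0, 1), (1, 0), (0, 2), (2, 0)] where
  inj := by decide +kernel
  P_le := by decide +kernel
  w_le := by decide +kernel
  w_ne := by decide +kernel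
  orient_ne := by decide +kernel
  side_ne := by decide +kernel
  side_mul := by decide +kernel
  w_eq := by decide +kernel
  sides := by decide +kernel
  triple := by decide +kernel

end BundleGraph

namespace BundleGraph

variable {ℓ : ℕ} {P w : Fin 18 → ℤ × ℤ} {C : List (Fin 21 × Fin 21)}

/-- The vertices of the blob `b` are spread from `P b` in direction `w b`. -/
def spread (P w : Fin 18 → ℤ × ℤ) (u : BundleVertex ℓ) : ℝ × ℝ :=
  realPoint (P u.1) + ((u.2 : ℕ) / (1000 * (35 * ℓ + 9)) : ℝ) • realPoint (w u.1)

/-- The side of the line in which the blob `b` is spread. -/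
def side (P w : Fin 18 → ℤ × ℤ) (b : Fin 18) (x : ℝ × ℝ) : ℝ :=
  orient (realPoint (P b)) (realPoint (P b + w b)) x

lemma side_add_smul (b : Fin 18) (x : ℝ × ℝ) (t : ℝ) :
    side P w b (x + t • realPoint (w b)) = side P w b x := by
  simp [side, orient, realPoint]
  ring

lemma side_spread_self (u : BundleVertex ℓ) : side P w u.1 (spread P w u) = 0 := by
  rw [spread, side_add_smul]
  simp [side, orient]

lemma orient_spread_of_fst_eq {u x : BundleVertex ℓ} (h : x.1 = u.1) (y : ℝ × ℝ) :
    orient (spread P w u) y (spread P w x) =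
      (((u.2 : ℕ) - (x.2 : ℕ) : ℝ) / (1000 * (35 * ℓ + 9))) * side P w u.1 y := by
  simp only [side, orient, spread, realPoint, h, Prod.fst_add, Prod.snd_add, Prod.smul_fst,
    Prod.smul_snd, smul_eq_mul]
  push_cast
  ring

lemma eq_of_fst_eq_of_lt {u x : BundleVertex ℓ} (h : u.1 = x.1) (hu : u.1 < 7) : u = x := by
  have hx := h ▸ hu
  have h1 := u.2.2
  have h2 := x.2.2
  simp only [blobSize, hu, hx, if_true] at h1 h2
  exact vertex_ext h (by omega)

lemma snd_ne_of_fst_eq {u x : BundleVertex ℓ} (h : u.1 = x.1) (hne : u ≠ x) :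
    ((u.2 : ℕ) : ℝ) ≠ (x.2 : ℕ) := fun h2 => hne (vertex_ext h (by exact_mod_cast h2))

lemma seven_le_of_ne {u x : BundleVertex ℓ} (h : u.1 = x.1) (hne : u ≠ x) : 7 ≤ u.1 :=
  not_lt.1 fun hu => hne (eq_of_fst_eq_of_lt h hu)

lemma exists_baseArc {u v : BundleVertex ℓ} (h : (bundleGraph ℓ).Adj u v) :
    ∃ d, baseArc d = (u.1, v.1) := by
  obtain ⟨k, hk | hk⟩ := h.1
  · exact ⟨(k, true), by simp [baseArc, hk]⟩
  · exact ⟨(k, false), by simp [baseArc, hk]⟩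

lemma snd_eq_of_adj {u v : BundleVertex ℓ} (h : (bundleGraph ℓ).Adj u v) (hu : 7 ≤ u.1)
    (hv : 7 ≤ v.1) : (u.2 : ℕ) = v.2 :=
  (h.2.resolve_left hu.not_gt).resolve_left hv.not_gt

lemma isNear_realPoint {a : ℤ × ℤ} (h1 : -50 ≤ a.1 ∧ a.1 ≤ 50) (h2 : -50 ≤ a.2 ∧ a.2 ≤ 50) :
    IsNear a (realPoint a) where
  fst_le := by exact_mod_cast abs_le.2 h1
  snd_le := by exact_mod_cast abs_le.2 h2
  fst_near := by simp [realPoint]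
  snd_near := by simp [realPoint]

namespace IsLayout

lemma isNear_base (h : IsLayout P w C) (b : Fin 18) : IsNear (P b) (realPoint (P b)) := by
  have := h.P_le b
  exact isNear_realPoint (by omega) (by omega)

lemma isNear_add (h : IsLayout P w C) (b : Fin 18) : IsNear (P b + w b)
    (realPoint (P b + w b)) := by
  have h1 := h.P_le b
  have h2 := h.w_le b
  refine isNear_realPoint ?_ ?_
  · rw [Prod.fst_add]; omega
  · rw [Prod.snd_add]; omega

lemma isNear_spread (h : IsLayout P w C) (u : BundleVertex ℓ) : IsNear (P u.1) (spread P w u) := by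
  have h0 := h.isNear_base u.1
  have hn : ((u.2 : ℕ) : ℝ) ≤ 35 * ℓ + 9 := by
    have h1 : (u.2 : ℕ) < blobSize ℓ u.1 := u.2.2
    have h2 : blobSize ℓ u.1 ≤ 35 * ℓ + 9 := by
      unfold blobSize
      split_ifs <;> omega
    exact_mod_cast h1.le.trans h2
  have key : ∀ x : ℤ, -1 ≤ x ∧ x ≤ 1 →
      |((u.2 : ℕ) / (1000 * (35 * ℓ + 9)) : ℝ) * x| ≤ 1 / 1000 := fun x hx => by
    have hx' : |(x : ℝ)| ≤ 1 := by exact_mod_cast abs_le.2 hx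
    rw [abs_mul, abs_of_nonneg (by positivity)]
    calc ((u.2 : ℕ) / (1000 * (35 * ℓ + 9)) : ℝ) * |(x : ℝ)|
        ≤ ((35 * ℓ + 9) / (1000 * (35 * ℓ + 9)) : ℝ) * 1 := by gcongr
      _ = 1 / 1000 := by field_simp
  refine ⟨h0.1, h0.2, ?_, ?_⟩
  · simpa [spread, realPoint] using key _ (h.w_le u.1).1
  · simpa [spread, realPoint] using key _ (h.w_le u.1).2

lemma side_spread_ne_zero (h : IsLayout P w C) {u v : BundleVertex ℓ}
    (huv : (bundleGraph ℓ).Adj u v) (hu : 7 ≤ u.1) :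
    side P w u.1 (spread P w v) ≠ 0 := by
  obtain ⟨d, hd⟩ := exists_baseArc huv
  have := h.side_ne d
  simp only [hd] at this
  exact orient_ne_zero_of_isNear (h.isNear_base _) (h.isNear_add _) (h.isNear_spread v) (this hu)

lemma side_spread_mul_neg (h : IsLayout P w C) {u v x z : BundleVertex ℓ}
    (huv : (bundleGraph ℓ).Adj u v) (hxz : (bundleGraph ℓ).Adj x z) (hx : x.1 = u.1)
    (hu : 7 ≤ u.1) (hvz : v.1 ≠ z.1) :
    side P w u.1 (spread P w v) * side P w u.1 (spread P w z) < 0 := by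
  obtain ⟨d, hd⟩ := exists_baseArc huv
  obtain ⟨d', hd'⟩ := exists_baseArc hxz
  have := h.side_mul d d'
  simp only [hd, hd'] at this
  exact orient_mul_neg_of_isNear (h.isNear_base _) (h.isNear_add _) (h.isNear_spread v)
    (h.isNear_spread z) (this hx hu hvz)

lemma realPoint_w_ne_zero (h : IsLayout P w C) {b : Fin 18} (hb : 7 ≤ b) : realPoint
    (w b) ≠ 0 := fun h0 =>
  h.w_ne b hb (by
    simp only [realPoint, Prod.ext_iff, Prod.fst_zero, Prod.snd_zero, Int.cast_eq_zero] at h0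
    exact Prod.ext h0.1 h0.2)

lemma spread_injective (h : IsLayout P w C) : Function.Injective
    (spread P w : BundleVertex ℓ → ℝ × ℝ) := by
  intro u x hux
  by_cases hb : u.1 = x.1
  · by_contra hne
    have h7 := seven_le_of_ne hb hne
    have h2 := snd_ne_of_fst_eq hb hne
    have h3 : (((u.2 : ℕ) - (x.2 : ℕ) : ℝ) / (1000 * (35 * ℓ + 9))) • realPoint (w u.1) = 0 := by
      simp only [spread, ← hb] at hux
      rw [sub_div]
      linear_combination (norm := module) hux
    rcases smul_eq_zero.1 h3 with h4 | h4
    · have : (1000 * (35 * ℓ + 9) : ℝ) ≠ 0 := by positivity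
      exact h2 (sub_eq_zero.1 ((div_eq_zero_iff.1 h4).resolve_right this))
    · exact h.realPoint_w_ne_zero h7 h4
  · refine (hb (h.inj _ _ ?_)).elim
    have h1 := h.isNear_spread u
    have h2 := h.isNear_spread x
    rw [hux] at h1
    have key : ∀ {a b : ℤ} {y : ℝ}, |y - a| ≤ 1 / 1000 → |y - b| ≤ 1 / 1000 → a = b := by
      intro a b y ha hb
      have h3 : |((a - b : ℤ) : ℝ)| < 1 := by
        push_cast
        rw [abs_le] at ha hb
        rw [abs_lt]
        constructor <;> linarith
      have h4 : |a - b| < 1 := by exact_mod_cast h3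
      exact sub_eq_zero.1 (Int.abs_lt_one_iff.1 h4)
    exact Prod.ext (key h1.3 h2.3) (key h1.4 h2.4)

lemma orient_spread_ne_zero (h : IsLayout P w C) {u v x : BundleVertex ℓ}
    (huv : (bundleGraph ℓ).Adj u v) (hxu : x ≠ u)
    (hxv : x ≠ v) : orient (spread P w u) (spread P w v) (spread P w x) ≠ 0 := by
  have key : ∀ {u v : BundleVertex ℓ}, (bundleGraph ℓ).Adj u v → x ≠ u → x.1 = u.1 →
      orient (spread P w u) (spread P w v) (spread P w x) ≠ 0 := by
    intro u v huv hxu hb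
    rw [orient_spread_of_fst_eq hb]
    exact mul_ne_zero (div_ne_zero (sub_ne_zero.2 (snd_ne_of_fst_eq hb.symm hxu.symm))
      (by positivity)) (h.side_spread_ne_zero huv (seven_le_of_ne hb.symm hxu.symm))
  by_cases hu : x.1 = u.1
  · exact key huv hxu hu
  by_cases hv : x.1 = v.1
  · rw [orient_swap_left]
    exact neg_ne_zero.2 (key huv.symm hxv hv)
  have base : ∀ {u v : BundleVertex ℓ} k, baseEdge k = (u.1, v.1) → x.1 ≠ u.1 → x.1 ≠ v.1 →
      orient (spread P w u) (spread P w v) (spread P w x) ≠ 0 := by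
    intro u v k hk hu hv
    have := h.orient_ne k x.1
    simp only [hk] at this
    exact orient_ne_zero_of_isNear (h.isNear_spread u) (h.isNear_spread v) (h.isNear_spread x)
      (this hu hv)
  obtain ⟨k, hk | hk⟩ := huv.1
  · exact base k hk hu hv
  · rw [orient_swap_left]
    exact neg_ne_zero.2 (base k hk hv hu)

lemma w_eq_of_adj (h : IsLayout P w C) {u v : BundleVertex ℓ} (huv : (bundleGraph ℓ).Adj u v)
    (hu : 7 ≤ u.1)
    (hv : 7 ≤ v.1) : w u.1 = w v.1 := by
  obtain ⟨k, hk | hk⟩ := huv.1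
  · have := h.w_eq k
    simp only [hk] at this
    exact this hu hv
  · have := h.w_eq k
    simp only [hk] at this
    exact (this hv hu).symm

lemma spread_sub_of_adj (h : IsLayout P w C) {u v : BundleVertex ℓ}
    (huv : (bundleGraph ℓ).Adj u v) (hu : 7 ≤ u.1)
    (hv : 7 ≤ v.1) :
    spread P w v - spread P w u = realPoint (P v.1) - realPoint (P u.1) := by
  simp only [spread, h.w_eq_of_adj huv hu hv, snd_eq_of_adj huv hu hv, add_sub_add_right_eq_sub]

lemma disjoint_segment_of_fst_eq (h : IsLayout P w C) {u v x z : BundleVertex ℓ}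
    (huv : (bundleGraph ℓ).Adj u v)
    (hxz : (bundleGraph ℓ).Adj x z) (hux : u ≠ x) (hvz : v ≠ z) (hb : u.1 = x.1) :
    Disjoint (segment ℝ (spread P w u) (spread P w v))
      (segment ℝ (spread P w x) (spread P w z)) := by
  have h7 := seven_le_of_ne hb hux
  refine Set.disjoint_left.2 fun p hp hp' => ?_
  obtain ⟨t, ht, rfl⟩ := mem_segment_iff.1 hp
  obtain ⟨s, hs, hts⟩ := mem_segment_iff.1 hp'
  have hside : t * side P w u.1 (spread P w v) = s * side P w u.1 (spread P w z) := by
    have h1 := congrArg (side P w u.1) hts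
    have hx : side P w u.1 (spread P w x) = 0 := by rw [hb]; exact side_spread_self x
    have hu : side P w u.1 (spread P w u) = 0 := side_spread_self u
    unfold side at h1 hx hu ⊢
    rw [orient_lineMap, orient_lineMap, hx, hu] at h1
    linarith
  by_cases hb' : v.1 = z.1
  · have h7' := seven_le_of_ne hb' hvz
    have hw := h.w_eq_of_adj huv h7 h7'
    have hi := snd_eq_of_adj huv h7 h7'
    have hj := snd_eq_of_adj hxz (hb ▸ h7) (hb' ▸ h7')
    have hvz' : side P w u.1 (spread P w v) = side P w u.1 (spread P w z) := by
      simp only [spread, ← hb', ← hw, side_add_smul]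
    rw [hvz'] at hside
    obtain rfl : t = s := mul_right_cancel₀ (hvz' ▸ h.side_spread_ne_zero huv h7) hside
    refine hux (h.spread_injective ?_)
    simp only [spread, ← hb, ← hb', ← hw, ← hi, ← hj] at hts ⊢
    linear_combination (norm := module) -hts
  · have hneg := h.side_spread_mul_neg huv hxz hb.symm h7 hb'
    have ht0 : t = 0 := by
      by_contra ht0
      have h1 : 0 < t := lt_of_le_of_ne ht.1 (Ne.symm ht0)
      have h2 : side P w u.1 (spread P w v) ≠ 0 := left_ne_zero_of_mul hneg.ne
      have h3 := mul_pos h1 (mul_self_pos.2 h2)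
      rw [← mul_assoc, hside] at h3
      nlinarith [mul_nonneg hs.1 (neg_pos.2 hneg).le]
    have hs0 : s = 0 := by
      have h2 : side P w u.1 (spread P w z) ≠ 0 := right_ne_zero_of_mul hneg.ne
      rw [ht0, zero_mul] at hside
      exact (mul_eq_zero.1 hside.symm).resolve_right h2
    refine hux (h.spread_injective ?_)
    simpa [ht0, hs0] using hts.symm

end IsLayout

/-- The edges `e` and `f` lie over a pair of edges of the base graph in `C`. -/
def LiesOver (C : List (Fin 21 × Fin 21)) (e f : Sym2 (BundleVertex ℓ)) : Prop :=
  ∃ k l, (k, l) ∈ C ∧ e.map Sigma.fst = s((baseEdge k).1, (baseEdge k).2) ∧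
    f.map Sigma.fst = s((baseEdge l).1, (baseEdge l).2)

lemma baseEdge_injective : ∀ k l, s((baseEdge k).1, (baseEdge k).2) =
    s((baseEdge l).1, (baseEdge l).2) → k = l := by decide +kernel

theorem IsLayout.exists_drawing (h : IsLayout P w C) (ℓ : ℕ) :
    ∃ Γ : Drawing (bundleGraph ℓ), Γ.IsStraight ∧ Γ.vpos = spread P w ∧
      (∀ e f p, Γ.Crossing e f p → LiesOver C e f) ∧
      ∀ e f, {p | Γ.Crossing e f p}.Subsingleton := by
  refine exists_straight_drawing h.spread_injective (fun u v x => h.orient_spread_ne_zero) ?_ ?_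
  · intro u v x z huv hxz hux huz hvx hvz hdis
    have h1 : u.1 ≠ x.1 := fun hb => hdis (h.disjoint_segment_of_fst_eq huv hxz hux hvz hb)
    have h2 : u.1 ≠ z.1 := fun hb => hdis (by
      rw [segment_symm ℝ (spread P w x)]
      exact h.disjoint_segment_of_fst_eq huv hxz.symm huz hvx hb)
    have h3 : v.1 ≠ x.1 := fun hb => hdis (by
      rw [segment_symm ℝ (spread P w u)]
      exact h.disjoint_segment_of_fst_eq huv.symm hxz hvx huz hb)
    have h4 : v.1 ≠ z.1 := fun hb => hdis (by
      rw [segment_symm ℝ (spread P w u), segment_symm ℝ (spread P w x)]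
      exact h.disjoint_segment_of_fst_eq huv.symm hxz.symm hvz hux hb)
    have key : ∀ {u v x z : BundleVertex ℓ} k l, baseEdge k = (u.1, v.1) → baseEdge l = (x.1, z.1) →
        u.1 ≠ x.1 → u.1 ≠ z.1 → v.1 ≠ x.1 → v.1 ≠ z.1 →
        ¬ Disjoint (segment ℝ (spread P w u) (spread P w v))
          (segment ℝ (spread P w x) (spread P w z)) → LiesOver C s(u, v) s(x, z) := by
      intro u v x z k l hk hl h1 h2 h3 h4 hdis
      have hs := h.sides k l
      simp only [hk, hl] at hs
      rcases hs h1 h2 h3 h4 with hs | hs | hs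
      · exact ⟨k, l, hs, by simp [hk], by simp [hl]⟩
      · exact (hdis (disjoint_segment_of_orient (orient_mul_pos_of_isNear (h.isNear_spread u)
          (h.isNear_spread v) (h.isNear_spread x) (h.isNear_spread z) hs))).elim
      · exact (hdis (disjoint_segment_of_orient (orient_mul_pos_of_isNear (h.isNear_spread x)
          (h.isNear_spread z) (h.isNear_spread u) (h.isNear_spread v) hs)).symm).elim
    obtain ⟨k, hk | hk⟩ := huv.1 <;> obtain ⟨l, hl | hl⟩ := hxz.1
    · exact key k l hk hl h1 h2 h3 h4 hdis
    · rw [segment_symm ℝ (spread P w x)] at hdis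
      rw [Sym2.eq_swap (a := x)]
      exact key k l hk hl h2 h1 h4 h3 hdis
    · rw [segment_symm ℝ (spread P w u)] at hdis
      rw [Sym2.eq_swap (a := u)]
      exact key k l hk hl h3 h4 h1 h2 hdis
    · rw [segment_symm ℝ (spread P w u), segment_symm ℝ (spread P w x)] at hdis
      rw [Sym2.eq_swap (a := u), Sym2.eq_swap (a := x)]
      exact key k l hk hl h4 h3 h2 h1 hdis
  · rintro e f g ⟨k, l, hkl, he, hf⟩ ⟨k', m, hkm, he', hg⟩ ⟨l', m', hlm, hf', hg'⟩
    obtain rfl := baseEdge_injective _ _ (he.symm.trans he')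
    obtain rfl := baseEdge_injective _ _ (hf.symm.trans hf')
    obtain rfl := baseEdge_injective _ _ (hg.symm.trans hg')
    exact h.triple _ hkl _ hkm rfl hlm

end BundleGraph

namespace BundleGraph

variable {ℓ : ℕ}

theorem exists_isRAC (ℓ : ℕ) : ∃ Γ : Drawing (bundleGraph ℓ), Γ.IsRAC := by
  obtain ⟨Γ, hstr, hpos, hover, -⟩ := isLayout_rac.exists_drawing ℓ
  refine ⟨Γ, hstr, fun u v x z huv hxz ⟨p, hp⟩ => ?_⟩
  have hA : ∀ {u v : BundleVertex ℓ}, (bundleGraph ℓ).Adj u v →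
      s(u, v).map Sigma.fst = s((baseEdge 16).1, (baseEdge 16).2) →
      (Γ.vpos v - Γ.vpos u).2 = 0 := fun {u v} huv h => by
    rcases Sym2.eq_iff.1 h with ⟨h1, h2⟩ | ⟨h1, h2⟩ <;>
    · rw [hpos, isLayout_rac.spread_sub_of_adj huv (by rw [h1]; decide) (by rw [h2]; decide),
        h1, h2]
      simp [realPoint, baseEdge]
  have hB : ∀ {u v : BundleVertex ℓ}, (bundleGraph ℓ).Adj u v →
      s(u, v).map Sigma.fst = s((baseEdge 19).1, (baseEdge 19).2) →
      (Γ.vpos v - Γ.vpos u).1 = 0 := fun {u v} huv h => by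
    rcases Sym2.eq_iff.1 h with ⟨h1, h2⟩ | ⟨h1, h2⟩ <;>
    · rw [hpos, isLayout_rac.spread_sub_of_adj huv (by rw [h1]; decide) (by rw [h2]; decide),
        h1, h2]
      simp [realPoint, baseEdge]
  obtain ⟨k, l, hkl, he, hf⟩ := hover _ _ p hp
  simp only [List.mem_cons, Prod.mk.injEq, List.not_mem_nil, or_false] at hkl
  rcases hkl with ⟨rfl, rfl⟩ | ⟨rfl, rfl⟩
  · rw [hA huv he, hB hxz hf]; ring
  · rw [hB huv he, hA hxz hf]; ring

lemma eq_hub {b : Fin 18} {u : BundleVertex ℓ} (hb : b < 7) (h : u.1 = b) : u = hub ℓ b hb :=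
  eq_of_fst_eq_of_lt h (h ▸ hb)

lemma eq_of_map_fst_eq {b c : Fin 18} (hb : b < 7) (hc : c < 7) {e : Sym2 (BundleVertex ℓ)}
    (h : e.map Sigma.fst = s(b, c)) : e = s(hub ℓ b hb, hub ℓ c hc) := by
  induction e with | _ u v
  rcases Sym2.eq_iff.1 h with ⟨h1, h2⟩ | ⟨h1, h2⟩
  · rw [eq_hub hb h1, eq_hub hc h2]
  · rw [eq_hub hc h1, eq_hub hb h2, Sym2.eq_swap]

theorem exists_crossings_le_two (ℓ : ℕ) : ∃ Γ : Drawing (bundleGraph ℓ), Γ.crossings ≤ 2 := by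
  obtain ⟨Γ, -, -, hover, huniq⟩ := isLayout_two.exists_drawing ℓ
  refine ⟨Γ, ?_⟩
  have hsub : Γ.crossingSet ⊆ {p | Γ.Crossing s(hub ℓ 0, hub ℓ 3) s(hub ℓ 1, hub ℓ 4) p} ∪
      {p | Γ.Crossing s(hub ℓ 0, hub ℓ 3) s(hub ℓ 1, hub ℓ 6) p} := by
    rintro p ⟨e, f, hp⟩
    obtain ⟨k, l, hkl, he, hf⟩ := hover _ _ p hp
    simp only [List.mem_cons, Prod.mk.injEq, List.not_mem_nil, or_false] at hkl
    rcases hkl with ⟨rfl, rfl⟩ | ⟨rfl, rfl⟩ | ⟨rfl, rfl⟩ | ⟨rfl, rfl⟩ <;>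
      rw [eq_of_map_fst_eq (by decide) (by decide) he,
        eq_of_map_fst_eq (by decide) (by decide) hf] at hp
    · exact .inl hp
    · exact .inl hp.symm
    · exact .inr hp
    · exact .inr hp.symm
  have hone : ∀ e f, {p | Γ.Crossing e f p}.ncard ≤ 1 := fun e f =>
    (Set.ncard_le_one (Γ.finite_setOf_crossing e f)).2 fun _ hp _ hq => huniq e f hp hq
  calc Γ.crossings ≤ _ := Set.ncard_le_ncard hsub
        ((Γ.finite_setOf_crossing _ _).union (Γ.finite_setOf_crossing _ _))
    _ ≤ _ := Set.ncard_union_le _ _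
    _ ≤ 1 + 1 := add_le_add (hone _ _) (hone _ _)

end BundleGraph

namespace Drawing

variable {V W : Type} {G : SimpleGraph V} {H : SimpleGraph W}

/-- The drawing of `G` induced by a drawing of an isomorphic graph. -/
def comap (φ : G ≃g H) (Γ : Drawing H) : Drawing G where
  vpos v := Γ.vpos (φ v)
  vpos_inj := Γ.vpos_inj.comp φ.injective
  arc u v := Γ.arc (φ u) (φ v)
  arc_symm u v := Γ.arc_symm _ _
  arc_cont u v h := Γ.arc_cont _ _ (φ.map_adj_iff.2 h)
  arc_injOn u v h := Γ.arc_injOn _ _ (φ.map_adj_iff.2 h)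
  arc_start u v h := Γ.arc_start _ _ (φ.map_adj_iff.2 h)
  arc_end u v h := Γ.arc_end _ _ (φ.map_adj_iff.2 h)
  arc_avoids u v h t ht := fun ⟨x, hx⟩ => Γ.arc_avoids _ _ (φ.map_adj_iff.2 h) t ht ⟨φ x, hx⟩
  inter_finite u v w z huv hwz hne := Γ.inter_finite _ _ _ _ (φ.map_adj_iff.2 huv)
    (φ.map_adj_iff.2 hwz) ((Sym2.map.injective φ.injective).ne hne)
  no_triple_point p hp u₁ v₁ u₂ v₂ u₃ v₃ h₁ h₂ h₃ h₁₂ h₁₃ h₂₃ :=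
    Γ.no_triple_point p (fun ⟨x, hx⟩ => hp ⟨φ.symm x, by simpa using hx⟩) _ _ _ _ _ _
      (φ.map_adj_iff.2 h₁) (φ.map_adj_iff.2 h₂) (φ.map_adj_iff.2 h₃)
      ((Sym2.map.injective φ.injective).ne h₁₂) ((Sym2.map.injective φ.injective).ne h₁₃)
      ((Sym2.map.injective φ.injective).ne h₂₃)

lemma comap_crossing (φ : G ≃g H) (Γ : Drawing H) {e f : Sym2 V} {p : ℝ × ℝ} :
    (Γ.comap φ).Crossing e f p ↔ Γ.Crossing (e.map φ) (f.map φ) p := by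
  induction e with | _ u v
  induction f with | _ w z
  have hr : range (Γ.comap φ).vpos = range Γ.vpos := φ.surjective.range_comp Γ.vpos
  refine and_congr φ.map_adj_iff.symm (and_congr φ.map_adj_iff.symm (and_congr
    (Sym2.map.injective φ.injective).ne_iff.symm (and_congr Iff.rfl (and_congr Iff.rfl ?_))))
  rw [hr]

lemma crossings_comap (φ : G ≃g H) (Γ : Drawing H) : (Γ.comap φ).crossings = Γ.crossings := by
  have hs : Function.Surjective (Sym2.map φ) := fun e => ⟨e.map φ.symm, by
    induction e with | _ u v
    simp⟩
  unfold crossings crossingSet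
  congr 1
  ext p
  simp only [Set.mem_ofPred_eq, comap_crossing]
  rw [← hs.exists (p := fun e => ∃ f, Γ.Crossing e (Sym2.map φ f) p)]
  exact exists_congr fun e => (hs.exists (p := fun f => Γ.Crossing e f p)).symm

lemma IsRAC.comap {Γ : Drawing H} (hΓ : Γ.IsRAC) (φ : G ≃g H) : (Γ.comap φ).IsRAC :=
  ⟨fun _ _ h => hΓ.1 _ _ (φ.map_adj_iff.2 h), fun _ _ _ _ huv hwz ⟨p, hp⟩ =>
    hΓ.2 _ _ _ _ (φ.map_adj_iff.2 huv) (φ.map_adj_iff.2 hwz) ⟨p, (comap_crossing φ Γ).1 hp⟩⟩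

end Drawing

lemma crNum_le {V : Type} {G : SimpleGraph V} (Γ : Drawing G) : crNum G ≤ Γ.crossings :=
  Nat.sInf_le ⟨Γ, rfl⟩

lemma crNumRestricted_le {V : Type} {G : SimpleGraph V} {P : Drawing G → Prop} {Γ : Drawing G}
    (hΓ : P Γ) : crNumRestricted G P ≤ Γ.crossings :=
  Nat.sInf_le ⟨Γ, hΓ, rfl⟩

lemma le_crNum {V : Type} {G : SimpleGraph V} {m : ℕ} (h : Nonempty (Drawing G))
    (hm : ∀ Γ : Drawing G, m ≤ Γ.crossings) : m ≤ crNum G := by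
  obtain ⟨Γ⟩ := h
  exact le_csInf ⟨_, Γ, rfl⟩ (by rintro _ ⟨Γ, rfl⟩; exact hm Γ)

lemma le_crNumRestricted {V : Type} {G : SimpleGraph V} {P : Drawing G → Prop} {m : ℕ}
    (h : ∃ Γ, P Γ) (hm : ∀ Γ, P Γ → m ≤ Γ.crossings) : m ≤ crNumRestricted G P := by
  obtain ⟨Γ, hΓ⟩ := h
  exact le_csInf ⟨_, Γ, hΓ, rfl⟩ (by rintro _ ⟨Γ, hΓ, rfl⟩; exact hm Γ hΓ)

theorem exists_graph_large_rac_crossing_number (ℓ : ℕ) (hℓ : 43 ≤ ℓ) :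
    ∃ G : SimpleGraph (Fin (45 * ℓ + 16)), (∃ Γ : Drawing G, Γ.IsRAC) ∧
      ℓ ^ 2 ≤ crNumRestricted G (fun Γ => Γ.IsRAC) ∧ 1 ≤ crNum G ∧ crNum G ≤ 2 := by
  let σ : Fin (45 * ℓ + 16) ≃ BundleVertex ℓ :=
    (Fintype.equivFinOfCardEq (BundleGraph.card_vertex ℓ)).symm
  let φ : (bundleGraph ℓ).comap σ ≃g bundleGraph ℓ := SimpleGraph.Iso.comap σ _
  obtain ⟨Γ, hΓ⟩ := BundleGraph.exists_isRAC ℓ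
  obtain ⟨Γ', hΓ'⟩ := BundleGraph.exists_crossings_le_two ℓ
  refine ⟨(bundleGraph ℓ).comap σ, ⟨_, hΓ.comap φ⟩, ?_, ?_, ?_⟩
  · refine le_crNumRestricted ⟨_, hΓ.comap φ⟩ fun Δ hΔ => ?_
    rw [← Δ.crossings_comap φ.symm]
    exact BundleGraph.sq_le_crossings hℓ (hΔ.comap φ.symm)
  · refine le_crNum ⟨Γ.comap φ⟩ fun Δ => ?_
    rw [← Δ.crossings_comap φ.symm]
    exact BundleGraph.one_le_crossings (by omega) _
  · exact (crNum_le (Γ'.comap φ)).trans ((Γ'.crossings_comap φ).trans_le hΓ')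

theorem crNumRestricted_isRAC_le {n : ℕ} {G : SimpleGraph (Fin n)}
    (h : ∃ Γ : Drawing G, Γ.IsRAC) : crNumRestricted G (fun Γ => Γ.IsRAC) ≤ 9 * n ^ 2 := by
  obtain ⟨Γ, hΓ⟩ := h
  have := (crNumRestricted_le (P := fun Γ : Drawing G => Γ.IsRAC) hΓ).trans hΓ.crossings_le
  rwa [Fintype.card_fin, mul_pow] at this

/-- For every `ℓ ≥ 95` there exists a simple graph admitting
a straight-line RAC drawing, on exactly `n = 45ℓ + 16` vertices, with
`cr_{RAC}(G) ≥ ℓ²` and `cr(G) ≤ 2`; moreover the straight-line RAC crossing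
ratio is `Θ(n²)`. -/
theorem rac_crossing_ratio (ℓ : ℕ) (hℓ : 95 ≤ ℓ) :
    (∃ G : SimpleGraph (Fin (45 * ℓ + 16)),
      (∃ Γ : Drawing G, Γ.IsRAC) ∧
      ℓ ^ 2 ≤ crNumRestricted G (fun Γ => Γ.IsRAC) ∧
      crNum G ≤ 2) ∧
    -- the straight-line RAC crossing ratio is O(n²):
    (∃ c : ℝ, 0 < c ∧ ∀ (n : ℕ) (G : SimpleGraph (Fin n)),
      (∃ Γ : Drawing G, Γ.IsRAC) → 1 ≤ crNum G →
      (crNumRestricted G (fun Γ => Γ.IsRAC) : ℝ) ≤ c * n ^ 2 * crNum G) ∧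
    -- the straight-line RAC crossing ratio is Ω(n²):
    (∃ c : ℝ, 0 < c ∧ ∀ N : ℕ, ∃ n, N ≤ n ∧ ∃ G : SimpleGraph (Fin n),
      (∃ Γ : Drawing G, Γ.IsRAC) ∧ 1 ≤ crNum G ∧
      c * n ^ 2 * crNum G ≤ (crNumRestricted G (fun Γ => Γ.IsRAC) : ℝ)) := by
  refine ⟨?_, ⟨9, by norm_num, fun n G hG hcr => ?_⟩, ⟨1 / 5000, by norm_num, fun N => ?_⟩⟩
  · obtain ⟨G, hG, hrac, -, hcr⟩ := exists_graph_large_rac_crossing_number ℓ (by omega)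
    exact ⟨G, hG, hrac, hcr⟩
  · calc (crNumRestricted G (fun Γ => Γ.IsRAC) : ℝ) ≤ 9 * n ^ 2 * 1 := by
          rw [mul_one]
          exact_mod_cast crNumRestricted_isRAC_le hG
      _ ≤ 9 * n ^ 2 * crNum G := by
          gcongr
          exact_mod_cast hcr
  · obtain ⟨m, hN, hm⟩ : ∃ m, N ≤ m ∧ 95 ≤ m := ⟨max N 95, le_max_left .., le_max_right ..⟩
    obtain ⟨G, hG, hrac, h1, h2⟩ := exists_graph_large_rac_crossing_number m (by omega)
    refine ⟨45 * m + 16, by omega, G, hG, h1, ?_⟩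
    have hn : ((45 * m + 16 : ℕ) : ℝ) ≤ 46 * m := by exact_mod_cast (by omega)
    have h2' : (crNum G : ℝ) ≤ 2 := by exact_mod_cast h2
    calc 1 / 5000 * ((45 * m + 16 : ℕ) : ℝ) ^ 2 * crNum G ≤ 1 / 5000 * (46 * m) ^ 2 * 2 := by gcongr
      _ ≤ (m : ℝ) ^ 2 := by nlinarith [sq_nonneg (m : ℝ)]
      _ ≤ _ := by exact_mod_cast hrac
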